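/- Let Ω ⊂ ℝ² be a UBC domain. There exists an independent constant C such that (i) ∫_Ω |∇X|² dx ≤ C ( ∫_Ω |∇_sym X|² dx + r_Ω^{−2} ∫_Ω |X|² dx ) for every X ∈ H¹(Ω; ℝ²); moreover, if η is the cutoff function for Ω, then (ii) ∫_Ω η |∇X|² dx ≤ C ( ∫_Ω η |∇_sym X|² dx + r_Ω^{−2} ∫_{Ω ∩ spt η} |X|² dx ) for every X ∈ H¹(Ω ∩ N_{r_Ω/2}(∂Ω); ℝ²). -/

import Mathlib

open MeasureTheory Metric Set Filter
open scoped RealInnerProductSpace ENNReal Topology NNReal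

noncomputable section

abbrev E2 : Type := EuclideanSpace ℝ (Fin 2)

namespace StokesPaper

/-- The `i`-th standard basis vector of `ℝ²`. -/
def e (i : Fin 2) : E2 := EuclideanSpace.single i (1 : ℝ)

/-- Rotation by +90°; produces the right-handed unit tangent `τ = (-ν₂, ν₁)`
from the outer normal `ν`. -/
def rot (v : E2) : E2 := ⟪v, e 0⟫ • e 1 - ⟪v, e 1⟫ • e 0

/-- The uniform ball condition (UBC) with radius `r`: at every boundary point there are
an open interior ball and an open exterior ball of radius `r` whose boundary spheres
meet exactly at that point. -/
def IsUBCWith (Ω : Set E2) (r : ℝ) : Prop :=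
  0 < r ∧ ∀ x ∈ frontier Ω, ∃ cIn cOut : E2,
    ball cIn r ⊆ Ω ∧ ball cOut r ⊆ Ωᶜ ∧ sphere cIn r ∩ sphere cOut r = {x}

/-- A UBC domain: a bounded domain satisfying the UBC for some radius. -/
def IsUBCDomain (Ω : Set E2) : Prop :=
  IsOpen Ω ∧ IsConnected Ω ∧ Bornology.IsBounded Ω ∧ ∃ r : ℝ, IsUBCWith Ω r

/-- The maximal UBC radius `r_Ω`. -/
def ubcRadius (Ω : Set E2) : ℝ := sSup {r : ℝ | IsUBCWith Ω r}

/-- The perimeter `P(Ω) = H¹(∂Ω)`. -/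
def perim (Ω : Set E2) : ℝ := (μH[1] (frontier Ω)).toReal

/-- The area `|Ω|`. -/
def area (Ω : Set E2) : ℝ := (volume Ω).toReal

/-- Boundary integral with respect to the 1-dimensional Hausdorff measure. -/
def bInt (Ω : Set E2) (f : E2 → ℝ) : ℝ := ∫ x in frontier Ω, f x ∂μH[1]

open Classical in
/-- The signed distance function `d_Ω` (negative inside `Ω`). -/
def sdist (Ω : Set E2) (x : E2) : ℝ :=
  if x ∈ Ω then -(infDist x (frontier Ω)) else infDist x Ω

/-- The tubular neighborhood `N_r(∂Ω)`. -/
def tubNbhd (Ω : Set E2) (r : ℝ) : Set E2 := {x : E2 | infDist x (frontier Ω) < r}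

/-- Pointwise vector Laplacian. -/
def vLap (u : E2 → E2) (x : E2) : E2 :=
  ∑ i : Fin 2, fderiv ℝ (fderiv ℝ u) x (e i) (e i)

/-- Pointwise gradient of a scalar function. -/
def gradv (f : E2 → ℝ) (x : E2) : E2 := ∑ i : Fin 2, fderiv ℝ f x (e i) • e i

/-- Pointwise divergence of a vector field. -/
def divg (u : E2 → E2) (x : E2) : ℝ := ∑ i : Fin 2, ⟪fderiv ℝ u x (e i), e i⟫

/-- The entry `(∇u)_{ij} = ∂_j u_i` of the gradient matrix. -/
def gradEntry (u : E2 → E2) (x : E2) (i j : Fin 2) : ℝ := ⟪fderiv ℝ u x (e j), e i⟫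

/-- The entry of the symmetric gradient `∇_sym u = (∇u + (∇u)ᵀ)/2`. -/
def symGradEntry (u : E2 → E2) (x : E2) (i j : Fin 2) : ℝ :=
  (gradEntry u x i j + gradEntry u x j i) / 2

/-- The symmetric gradient applied to a vector. -/
def symGradApp (u : E2 → E2) (x v : E2) : E2 :=
  ∑ i : Fin 2, (∑ j : Fin 2, symGradEntry u x i j * ⟪v, e j⟫) • e i

/-- Squared Frobenius norm `|∇u|²`. -/
def gradNormSq (u : E2 → E2) (x : E2) : ℝ :=
  ∑ i : Fin 2, ∑ j : Fin 2, (gradEntry u x i j)^2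

/-- Squared Frobenius norm `|∇_sym u|²`. -/
def symGradNormSq (u : E2 → E2) (x : E2) : ℝ :=
  ∑ i : Fin 2, ∑ j : Fin 2, (symGradEntry u x i j)^2

/-- `ν` is the outer unit normal of `Ω` at the boundary point `x`, characterized via the
interior and exterior tangent balls of the uniform ball condition. -/
def IsOuterNormalAt (Ω : Set E2) (x ν : E2) : Prop :=
  ‖ν‖ = 1 ∧ ∀ r : ℝ, IsUBCWith Ω r →
    ball (x - r • ν) r ⊆ Ω ∧ ball (x + r • ν) r ⊆ Ωᶜ

/-- `∫_Ω |∇^k u|² dx`. -/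
def derivSq (k : ℕ) (Ω : Set E2) (u : E2 → E2) : ℝ :=
  ∫ x in Ω, ‖iteratedFDeriv ℝ k u x‖^2

/-- Squared Sobolev norm `‖u‖²_{H^n(Ω)}`. -/
def hSobSq (n : ℕ) (Ω : Set E2) (u : E2 → E2) : ℝ :=
  ∑ k ∈ Finset.range (n + 1), derivSq k Ω u

section plane
variable {E : Type*} [NormedAddCommGroup E] [NormedSpace ℝ E] [FiniteDimensional ℝ E]
  [MeasurableSpace E] [BorelSpace E] {μ : Measure E} [μ.IsAddHaarMeasure]

lemma plane_identity_smooth {w v : E → ℝ} {a b : E} (hw : ContDiff ℝ 2 w)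
    (hcw : HasCompactSupport w) (hv : Differentiable ℝ v)
    (hva : LocallyIntegrable (fun x => fderiv ℝ v x a) μ)
    (hvb : LocallyIntegrable (fun x => fderiv ℝ v x b) μ) :
    ∫ x, fderiv ℝ w x a * fderiv ℝ v x b ∂μ = ∫ x, fderiv ℝ w x b * fderiv ℝ v x a ∂μ := by
  have key : ∀ (c d : E), LocallyIntegrable (fun x => fderiv ℝ v x d) μ →
      ∫ x, fderiv ℝ w x c * fderiv ℝ v x d ∂μ
        = -∫ x, fderiv ℝ (fderiv ℝ w) x d c * v x ∂μ := by
    intro c d hd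
    have h1 : ContDiff ℝ 1 (fderiv ℝ w) := hw.fderiv_right (by norm_num)
    have h2 : ∀ x, HasFDerivAt (fun x => fderiv ℝ w x c)
        ((fderiv ℝ (fderiv ℝ w) x).flip c) x := by
      intro x
      have h3 : HasFDerivAt (fderiv ℝ w) (fderiv ℝ (fderiv ℝ w) x) x :=
        ((h1.differentiable (by norm_num)) x).hasFDerivAt
      have := h3.clm_apply (hasFDerivAt_const c x)
      convert! this using 1
      ext y; simp
    have hfd : ∀ x, fderiv ℝ (fun x => fderiv ℝ w x c) x d = fderiv ℝ (fderiv ℝ w) x d c := by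
      intro x; rw [(h2 x).fderiv]; simp
    have hc1 : HasCompactSupport (fun x => fderiv ℝ w x c) := hcw.fderiv_apply (𝕜 := ℝ) c
    have hc2 : HasCompactSupport (fun x => fderiv ℝ (fun x => fderiv ℝ w x c) x d) :=
      hc1.fderiv_apply (𝕜 := ℝ) d
    have hcont1 : Continuous (fun x => fderiv ℝ w x c) := h1.continuous.clm_apply continuous_const
    have hcont2 : Continuous (fun x => fderiv ℝ (fun x => fderiv ℝ w x c) x d) := by
      simp only [hfd]
      exact ((h1.continuous_fderiv (by norm_num)).clm_apply continuous_const).clm_apply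
        continuous_const
    have := integral_mul_fderiv_eq_neg_fderiv_mul_of_integrable (μ := μ)
      (f := fun x => fderiv ℝ w x c) (g := v) (v := d)
      ((hcont2.mul hv.continuous).integrable_of_hasCompactSupport hc2.mul_right)
      (hd.integrable_smul_left_of_hasCompactSupport hcont1 hc1)
      ((hcont1.mul hv.continuous).integrable_of_hasCompactSupport hc1.mul_right)
      (fun x _ => (h2 x).differentiableAt) (fun x _ => hv x)
    rw [this]
    simp only [hfd]
  rw [key a b hvb, key b a hva]
  congr 1
  apply integral_congr_ae
  filter_upwards with x
  have : IsSymmSndFDerivAt ℝ w x := hw.contDiffAt.isSymmSndFDerivAt (by simp)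
  rw [this.eq]

lemma continuous_translate_inner {g h : E → ℝ} (hg : MemLp g 2 μ) (hh : MemLp h 2 μ) :
    Continuous (fun t : E => ∫ x, g (x + t) * h x ∂μ) := by
  let τ : E → C(E, E) := fun t => ⟨fun x => x + t, by fun_prop⟩
  have hτ : Continuous τ := by
    refine ContinuousMap.continuous_of_continuous_uncurry _ ?_
    simp only [τ, Function.uncurry_def]
    exact continuous_snd.add continuous_fst
  have hm : ∀ t, MeasurePreserving (τ t) μ μ := fun t => measurePreserving_add_right μ t
  have hcont := (continuous_const (y := hg.toLp g)).compMeasurePreservingLp hτ hm (by simp)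
  have h2 : Continuous (fun t : E => ⟪hh.toLp h,
      Lp.compMeasurePreserving (τ t) (hm t) (hg.toLp g)⟫) := continuous_const.inner hcont
  convert h2 using 2 with t
  rw [L2.inner_def]
  apply integral_congr_ae
  have e1 := (hm t).quasiMeasurePreserving.ae_eq_comp hg.coeFn_toLp
  filter_upwards [Lp.coeFn_compMeasurePreserving (hg.toLp g) (hm t), hh.coeFn_toLp, e1]
    with x h1 h2 h3
  simp only [RCLike.inner_apply, conj_trivial]
  rw [h1, h2, h3]
  rfl

lemma fderiv_mollify {u ρ : E → ℝ} (hρ : ContDiff ℝ 1 ρ) (hcρ : HasCompactSupport ρ)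
    (hu : Differentiable ℝ u) (a : E) (hua : Integrable (fun x => fderiv ℝ u x a) μ)
    (x : E) :
    fderiv ℝ (convolution ρ u (ContinuousLinearMap.lsmul ℝ ℝ) μ) x a
      = ∫ t, ρ t * fderiv ℝ u (x - t) a ∂μ := by
  have h1 := hcρ.hasFDerivAt_convolution_left (ContinuousLinearMap.lsmul ℝ ℝ) hρ
    (hu.continuous.locallyIntegrable (μ := μ)) x
  rw [h1.fderiv]
  have hcont : Continuous (fderiv ℝ ρ) := hρ.continuous_fderiv (by norm_num)
  have hex : ConvolutionExistsAt (fderiv ℝ ρ) u x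
      ((ContinuousLinearMap.lsmul ℝ ℝ : ℝ →L[ℝ] ℝ →L[ℝ] ℝ).precompL E) μ :=
    (hcρ.fderiv (𝕜 := ℝ)).convolutionExists_left _ hcont
      (hu.continuous.locallyIntegrable (μ := μ)) x
  rw [convolution_def, ContinuousLinearMap.integral_apply hex]
  have hd : ∀ t, HasFDerivAt (fun t => u (x - t)) (-(fderiv ℝ u (x - t))) t := by
    intro t
    have := (hu (x - t)).hasFDerivAt.comp t ((hasFDerivAt_id t).const_sub x)
    convert! this using 1
    ext; simp
  have hca : HasCompactSupport (fun x => fderiv ℝ ρ x a) := hcρ.fderiv_apply (𝕜 := ℝ) a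
  have hcu : Continuous (fun t => u (x - t)) := hu.continuous.comp (by fun_prop)
  have hcona : Continuous (fun x => fderiv ℝ ρ x a) := hcont.clm_apply continuous_const
  have hloc : LocallyIntegrable (fun t => fderiv ℝ (fun t => u (x - t)) t a) μ := by
    have e : (fun t => fderiv ℝ (fun t => u (x - t)) t a) = fun t => -(fderiv ℝ u (x - t) a) := by
      ext t; rw [(hd t).fderiv]; simp
    rw [e]
    apply LocallyIntegrable.neg
    exact (hua.comp_sub_left x).locallyIntegrable
  have := integral_mul_fderiv_eq_neg_fderiv_mul_of_integrable (μ := μ)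
      (f := ρ) (g := fun t => u (x - t)) (v := a)
      ((hcona.mul hcu).integrable_of_hasCompactSupport hca.mul_right)
      (hloc.integrable_smul_left_of_hasCompactSupport hρ.continuous hcρ)
      ((hρ.continuous.mul hcu).integrable_of_hasCompactSupport hcρ.mul_right)
      (fun x _ => (hρ.differentiable (by norm_num)) x) (fun t _ => (hd t).differentiableAt)
  have e2 : ∀ t, ρ t * fderiv ℝ u (x - t) a = -(ρ t * fderiv ℝ (fun t => u (x - t)) t a) := by
    intro t; rw [(hd t).fderiv]; simp
  simp only [e2]
  rw [integral_neg, this, neg_neg]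
  apply integral_congr_ae
  filter_upwards with t
  simp [ContinuousLinearMap.precompL_apply]

lemma mollify_pair {ρ g h : E → ℝ} (hρ : Continuous ρ) (hcρ : HasCompactSupport ρ)
    (hg : Integrable g μ) (hh : MemLp h 2 μ) (hg2 : MemLp g 2 μ) :
    ∫ x, (∫ t, ρ t * g (x - t) ∂μ) * h x ∂μ
      = convolution ρ (fun t => ∫ x, g (x + t) * h x ∂μ) (ContinuousLinearMap.lsmul ℝ ℝ) μ 0 := by
  have hρ1 : Integrable ρ μ := hρ.integrable_of_hasCompactSupport hcρ
  obtain ⟨M, hM⟩ := hcρ.exists_bound_of_continuous hρ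
  have hF : Integrable (Function.uncurry fun x t => ρ t * g (x - t) * h x) (μ.prod μ) := by
    have hmeas : AEStronglyMeasurable (Function.uncurry fun x t => ρ t * g (x - t) * h x)
        (μ.prod μ) := by
      have := (hρ1.convolution_integrand (ContinuousLinearMap.lsmul ℝ ℝ) hg).aestronglyMeasurable
      exact this.mul (hh.aestronglyMeasurable.comp_fst)
    have hmeas' : AEStronglyMeasurable (Function.uncurry fun t x => ρ t * g (x - t) * h x)
        (μ.prod μ) := hmeas.prod_swap
    rw [← integrable_swap_iff]
    change Integrable (Function.uncurry fun t x => ρ t * g (x - t) * h x) (μ.prod μ)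
    rw [integrable_prod_iff hmeas']
    have hgt : ∀ t, MemLp (fun x => g (x - t)) 2 μ := fun t =>
      hg2.comp_measurePreserving (measurePreserving_sub_right μ t)
    constructor
    · filter_upwards with t
      have := ((hgt t).integrable_mul hh).const_mul (ρ t)
      simpa [Function.uncurry, mul_assoc] using! this
    · have hb : ∀ t, ∫ x, ‖g (x - t) * h x‖ ∂μ ≤ ∫ x, (g x ^ 2 + h x ^ 2) ∂μ := by
        intro t
        have i1 := (hgt t).integrable_sq
        calc ∫ x, ‖g (x - t) * h x‖ ∂μ ≤ ∫ x, (g (x-t) ^ 2 + h x ^ 2) ∂μ := by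
              apply integral_mono ((hgt t).integrable_mul hh).norm (i1.add hh.integrable_sq)
              intro x
              simp only [Pi.mul_apply, Pi.add_apply, norm_mul, Real.norm_eq_abs]
              nlinarith [sq_nonneg (|g (x-t)| - |h x|), sq_abs (g (x-t)), sq_abs (h x),
                sq_nonneg (g (x-t)), sq_nonneg (h x)]
          _ = _ := by
              rw [integral_add i1 hh.integrable_sq, integral_add hg2.integrable_sq hh.integrable_sq,
                integral_sub_right_eq_self (fun x => g x ^ 2) t]
      refine Integrable.mono' (hρ1.norm.mul_const (∫ x, (g x ^ 2 + h x ^ 2) ∂μ)) ?_ ?_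
      · exact hmeas'.norm.integral_prod_right'
      · filter_upwards with t
        rw [Real.norm_of_nonneg (integral_nonneg fun _ => norm_nonneg _)]
        simp only [Function.uncurry, mul_assoc]
        simp only [norm_mul (ρ t)]
        rw [integral_const_mul]
        exact mul_le_mul_of_nonneg_left (hb t) (norm_nonneg _)
  have := integral_integral_swap hF
  simp only [integral_mul_const] at this
  rw [this, convolution_def]
  apply integral_congr_ae
  filter_upwards with t
  simp only [mul_assoc, integral_const_mul, ContinuousLinearMap.lsmul_apply, smul_eq_mul,
    sub_eq_add_neg, zero_add]

lemma plane_identity {u v : E → ℝ} {a b : E} (hu : Differentiable ℝ u) (hv : Differentiable ℝ v)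
    (hcu : HasCompactSupport u)
    (hua : MemLp (fun x => fderiv ℝ u x a) 2 μ) (hub : MemLp (fun x => fderiv ℝ u x b) 2 μ)
    (hva : MemLp (fun x => fderiv ℝ v x a) 2 μ) (hvb : MemLp (fun x => fderiv ℝ v x b) 2 μ) :
    ∫ x, fderiv ℝ u x a * fderiv ℝ v x b ∂μ = ∫ x, fderiv ℝ u x b * fderiv ℝ v x a ∂μ := by
  let φ : ℕ → ContDiffBump (0 : E) := fun n =>
    ⟨1 / ((n : ℝ) + 1) / 2, 1 / ((n : ℝ) + 1), by positivity, by
      have : 0 < 1 / ((n : ℝ) + 1) := by positivity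
      linarith⟩
  have hφ : Tendsto (fun n => (φ n).rOut) atTop (𝓝 0) := tendsto_one_div_add_atTop_nhds_zero_nat
  have hderL2 : ∀ c, MemLp (fun x => fderiv ℝ u x c) 2 μ →
      Integrable (fun x => fderiv ℝ u x c) μ := by
    intro c hc
    rw [← memLp_one_iff_integrable]
    have hK : HasCompactSupport (fun x => fderiv ℝ u x c) := hcu.fderiv_apply (𝕜 := ℝ) c
    refine hc.mono_exponent_of_measure_support_ne_top (s := tsupport (fun x => fderiv ℝ u x c))
      (fun x hx => image_eq_zero_of_notMem_tsupport (f := fun x => fderiv ℝ u x c) hx) ?_ (by norm_num)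
    exact hK.isCompact.measure_lt_top.ne
  have hlim : ∀ c d, MemLp (fun x => fderiv ℝ u x c) 2 μ → MemLp (fun x => fderiv ℝ v x d) 2 μ →
      Tendsto (fun n => ∫ x, fderiv ℝ (convolution ((φ n).normed μ) u
        (ContinuousLinearMap.lsmul ℝ ℝ) μ) x c * fderiv ℝ v x d ∂μ) atTop
        (𝓝 (∫ x, fderiv ℝ u x c * fderiv ℝ v x d ∂μ)) := by
    intro c d hc hd
    have hG := continuous_translate_inner hc hd
    have := ContDiffBump.convolution_tendsto_right_of_continuous (μ := μ) hφ hG 0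
    simp only [add_zero] at this
    refine this.congr ?_
    intro n
    rw [← mollify_pair (φ n).continuous_normed (φ n).hasCompactSupport_normed (hderL2 c hc) hd hc]
    congr 1; ext x
    rw [fderiv_mollify (φ n).contDiff_normed (φ n).hasCompactSupport_normed hu c
      (hderL2 c hc)]
  refine tendsto_nhds_unique (hlim a b hua hvb) ((hlim b a hub hva).congr ?_)
  intro n
  refine (plane_identity_smooth ?_ ?_ hv (hva.locallyIntegrable (by norm_num))
    (hvb.locallyIntegrable (by norm_num))).symm
  · exact (φ n).hasCompactSupport_normed.contDiff_convolution_left (n := 2) _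
      (φ n).contDiff_normed (hu.continuous.locallyIntegrable)
  · exact (φ n).hasCompactSupport_normed.convolution _ hcu

lemma plane_korn {u v : E → ℝ} {a b : E} (hu : Differentiable ℝ u) (hv : Differentiable ℝ v)
    (hcu : HasCompactSupport u)
    (hua : MemLp (fun x => fderiv ℝ u x a) 2 μ) (hub : MemLp (fun x => fderiv ℝ u x b) 2 μ)
    (hva : MemLp (fun x => fderiv ℝ v x a) 2 μ) (hvb : MemLp (fun x => fderiv ℝ v x b) 2 μ) :
    ∫ x, (fderiv ℝ u x a ^ 2 + fderiv ℝ u x b ^ 2 + fderiv ℝ v x a ^ 2 + fderiv ℝ v x b ^ 2) ∂μ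
      ≤ ∫ x, (2 * fderiv ℝ u x a ^ 2 + 2 * fderiv ℝ v x b ^ 2
          + (fderiv ℝ u x b + fderiv ℝ v x a) ^ 2) ∂μ := by
  have hid := plane_identity hu hv hcu hua hub hva hvb
  have i1 : Integrable (fun x => fderiv ℝ u x a * fderiv ℝ v x b) μ := hua.integrable_mul hvb
  have i2 : Integrable (fun x => fderiv ℝ u x b * fderiv ℝ v x a) μ := hub.integrable_mul hva
  have i3 : Integrable (fun x => fderiv ℝ u x a ^ 2 + fderiv ℝ u x b ^ 2 + fderiv ℝ v x a ^ 2
      + fderiv ℝ v x b ^ 2) μ :=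
    ((hua.integrable_sq.add hub.integrable_sq).add hva.integrable_sq).add hvb.integrable_sq
  have i4 : Integrable (fun x => 2 * fderiv ℝ u x a ^ 2 + 2 * fderiv ℝ v x b ^ 2
          + (fderiv ℝ u x b + fderiv ℝ v x a) ^ 2) μ :=
    ((hua.integrable_sq.const_mul 2).add (hvb.integrable_sq.const_mul 2)).add
      (hub.add hva).integrable_sq
  have e : ∫ x, (fderiv ℝ u x a ^ 2 + fderiv ℝ u x b ^ 2 + fderiv ℝ v x a ^ 2
      + fderiv ℝ v x b ^ 2) ∂μ = ∫ x, ((fderiv ℝ u x a ^ 2 + fderiv ℝ u x b ^ 2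
      + fderiv ℝ v x a ^ 2 + fderiv ℝ v x b ^ 2) + 2 * (fderiv ℝ u x b * fderiv ℝ v x a
      - fderiv ℝ u x a * fderiv ℝ v x b)) ∂μ := by
    have i5 : Integrable (fun x => 2 * (fderiv ℝ u x b * fderiv ℝ v x a
      - fderiv ℝ u x a * fderiv ℝ v x b)) μ := (i2.sub i1).const_mul 2
    rw [integral_add i3 i5, integral_const_mul]
    have : ∫ x, (fderiv ℝ u x b * fderiv ℝ v x a - fderiv ℝ u x a * fderiv ℝ v x b) ∂μ = 0 := by
      rw [integral_sub i2 i1, hid, sub_self]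
    rw [this]; ring
  rw [e]
  refine integral_mono (i3.add ((i2.sub i1).const_mul 2)) i4 ?_
  intro x
  dsimp
  nlinarith [sq_nonneg (fderiv ℝ u x a + fderiv ℝ v x b)]

end plane

/-- affine map used in the reflection -/
def aff (δ k : ℝ) (p : ℝ × ℝ) : ℝ × ℝ := (p.1, k * p.2 + δ)

lemma aff_hasFDerivAt (δ k : ℝ) (p : ℝ × ℝ) :
    HasFDerivAt (aff δ k) ((ContinuousLinearMap.fst ℝ ℝ ℝ).prod
      (k • ContinuousLinearMap.snd ℝ ℝ ℝ)) p := by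
  have h1 : HasFDerivAt (fun p : ℝ × ℝ => p.1) (ContinuousLinearMap.fst ℝ ℝ ℝ) p := hasFDerivAt_fst
  have h2 : HasFDerivAt (fun p : ℝ × ℝ => k * p.2 + δ) (k • ContinuousLinearMap.snd ℝ ℝ ℝ) p := by
    have : HasFDerivAt (fun p : ℝ × ℝ => p.2) (ContinuousLinearMap.snd ℝ ℝ ℝ) p := hasFDerivAt_snd
    exact (this.const_mul k).add_const δ
  exact h1.prodMk h2

lemma measurable_aff (δ k : ℝ) : Measurable (aff δ k) := by
  unfold aff; fun_prop

lemma lintegral_aff (δ k : ℝ) (hk : k ≠ 0) (g : ℝ × ℝ → ℝ≥0∞) (hg : Measurable g) :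
    ∫⁻ p, g (aff δ k p) = ENNReal.ofReal |k⁻¹| * ∫⁻ p, g p := by
  have hm : AEMeasurable (fun p => g (aff δ k p)) (volume.prod volume) :=
    (hg.comp (measurable_aff δ k)).aemeasurable
  rw [Measure.volume_eq_prod, lintegral_prod _ hm, lintegral_prod _ hg.aemeasurable]
  rw [← lintegral_const_mul _ (Measurable.lintegral_prod_right' hg)]
  congr 1; ext x
  have hgx : Measurable (fun y => g (x, y)) := hg.comp (by fun_prop)
  calc ∫⁻ y, g (x, k * y + δ) = ∫⁻ z, g (x, z + δ) ∂(Measure.map (fun y => k * y) volume) := by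
        have hz : Measurable (fun z => g (x, z + δ)) := hg.comp (by fun_prop)
        rw [lintegral_map hz (by fun_prop)]
    _ = ENNReal.ofReal |k⁻¹| * ∫⁻ z, g (x, z + δ) := by
        rw [Real.map_volume_mul_left hk, lintegral_smul_measure, smul_eq_mul]
    _ = _ := by
        rw [lintegral_add_right_eq_self (fun z => g (x, z)) δ]

lemma lintegral_aff_le (δ k : ℝ) (hk : 1 ≤ |k|) (g : ℝ × ℝ → ℝ≥0∞) (hg : Measurable g) :
    ∫⁻ p, g (aff δ k p) ≤ ∫⁻ p, g p := by
  have : k ≠ 0 := by rintro rfl; simp at hk; linarith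
  rw [lintegral_aff δ k this g hg]
  calc _ ≤ 1 * ∫⁻ p, g p := by
        gcongr
        rw [ENNReal.ofReal_le_one, abs_inv]
        exact inv_le_one_of_one_le₀ hk
    _ = _ := one_mul _

/-- three-term reflection -/
def refl3 (c₁ c₂ c₃ δ : ℝ) (u : ℝ × ℝ → ℝ) (p : ℝ × ℝ) : ℝ :=
  if 0 ≤ p.2 then u (aff δ 1 p)
  else c₁ * u (aff δ (-1) p) + c₂ * u (aff δ (-2) p) + c₃ * u (aff δ (-3) p)

lemma refl3_lower {c₁ c₂ c₃ δ : ℝ} {u : ℝ × ℝ → ℝ} (hδ : 0 < δ)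
    (hu : DifferentiableOn ℝ u {p | 0 < p.2}) (p : ℝ × ℝ) (hp : p.2 ≤ 0) :
    HasFDerivAt (fun p => c₁ * u (aff δ (-1) p) + c₂ * u (aff δ (-2) p) + c₃ * u (aff δ (-3) p))
      (c₁ • (fderiv ℝ u (aff δ (-1) p)).comp ((ContinuousLinearMap.fst ℝ ℝ ℝ).prod
      ((-1:ℝ) • ContinuousLinearMap.snd ℝ ℝ ℝ)) +
      c₂ • (fderiv ℝ u (aff δ (-2) p)).comp ((ContinuousLinearMap.fst ℝ ℝ ℝ).prod
      ((-2:ℝ) • ContinuousLinearMap.snd ℝ ℝ ℝ)) +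
      c₃ • (fderiv ℝ u (aff δ (-3) p)).comp ((ContinuousLinearMap.fst ℝ ℝ ℝ).prod
      ((-3:ℝ) • ContinuousLinearMap.snd ℝ ℝ ℝ))) p := by
  have hop : IsOpen {p : ℝ × ℝ | 0 < p.2} := isOpen_lt continuous_const continuous_snd
  have key : ∀ k : ℝ, k ≤ 0 → HasFDerivAt (fun p => u (aff δ k p))
      ((fderiv ℝ u (aff δ k p)).comp ((ContinuousLinearMap.fst ℝ ℝ ℝ).prod
      (k • ContinuousLinearMap.snd ℝ ℝ ℝ))) p := by
    intro k hk
    have : aff δ k p ∈ {p : ℝ × ℝ | 0 < p.2} := by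
      show 0 < k * p.2 + δ; nlinarith
    exact ((hu.differentiableAt (hop.mem_nhds this)).hasFDerivAt).comp p (aff_hasFDerivAt δ k p)
  exact (((key (-1) (by norm_num)).const_mul c₁).add ((key (-2) (by norm_num)).const_mul c₂)).add
    ((key (-3) (by norm_num)).const_mul c₃)

lemma refl3_upper {δ : ℝ} {u : ℝ × ℝ → ℝ} (hδ : 0 < δ)
    (hu : DifferentiableOn ℝ u {p | 0 < p.2}) (p : ℝ × ℝ) (hp : 0 ≤ p.2) :
    HasFDerivAt (fun p => u (aff δ 1 p)) (fderiv ℝ u (aff δ 1 p)) p := by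
  have hop : IsOpen {p : ℝ × ℝ | 0 < p.2} := isOpen_lt continuous_const continuous_snd
  have : aff δ 1 p ∈ {p : ℝ × ℝ | 0 < p.2} := by
      show 0 < 1 * p.2 + δ; nlinarith
  have h := ((hu.differentiableAt (hop.mem_nhds this)).hasFDerivAt).comp p (aff_hasFDerivAt δ 1 p)
  convert! h using 1
  ext <;> simp

lemma refl3_fderiv_neg {c₁ c₂ c₃ δ : ℝ} {u : ℝ × ℝ → ℝ} (hδ : 0 < δ)
    (hu : DifferentiableOn ℝ u {p | 0 < p.2}) (p : ℝ × ℝ) (hp : p.2 < 0) :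
    HasFDerivAt (refl3 c₁ c₂ c₃ δ u)
      (c₁ • (fderiv ℝ u (aff δ (-1) p)).comp ((ContinuousLinearMap.fst ℝ ℝ ℝ).prod
      ((-1:ℝ) • ContinuousLinearMap.snd ℝ ℝ ℝ)) +
      c₂ • (fderiv ℝ u (aff δ (-2) p)).comp ((ContinuousLinearMap.fst ℝ ℝ ℝ).prod
      ((-2:ℝ) • ContinuousLinearMap.snd ℝ ℝ ℝ)) +
      c₃ • (fderiv ℝ u (aff δ (-3) p)).comp ((ContinuousLinearMap.fst ℝ ℝ ℝ).prod
      ((-3:ℝ) • ContinuousLinearMap.snd ℝ ℝ ℝ))) p := by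
  refine (refl3_lower hδ hu p hp.le).congr_of_eventuallyEq ?_
  have : {q : ℝ × ℝ | q.2 < 0} ∈ 𝓝 p := (isOpen_lt continuous_snd continuous_const).mem_nhds hp
  filter_upwards [this] with q hq
  have hq : q.2 < 0 := hq
  simp [refl3, not_le.2 hq]

lemma refl3_fderiv_nonneg {c₁ c₂ c₃ δ : ℝ} {u : ℝ × ℝ → ℝ} (hδ : 0 < δ)
    (h1 : c₁ + c₂ + c₃ = 1) (h2 : c₁ + 2 * c₂ + 3 * c₃ = -1)
    (hu : DifferentiableOn ℝ u {p | 0 < p.2}) (p : ℝ × ℝ) (hp : 0 ≤ p.2) :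
    HasFDerivAt (refl3 c₁ c₂ c₃ δ u) (fderiv ℝ u (aff δ 1 p)) p := by
  rcases hp.lt_or_eq with hp' | hp'
  · refine (refl3_upper hδ hu p hp).congr_of_eventuallyEq ?_
    have : {q : ℝ × ℝ | 0 < q.2} ∈ 𝓝 p := (isOpen_lt continuous_const continuous_snd).mem_nhds hp'
    filter_upwards [this] with q hq
    have hq : 0 < q.2 := hq
    simp [refl3, hq.le]
  · have hA : HasFDerivWithinAt (refl3 c₁ c₂ c₃ δ u) (fderiv ℝ u (aff δ 1 p)) {q | 0 ≤ q.2} p := by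
      refine (refl3_upper hδ hu p hp).hasFDerivWithinAt.congr ?_ ?_
      · intro q hq; have hq : 0 ≤ q.2 := hq; simp [refl3, hq]
      · simp [refl3, hp]
    have hB : HasFDerivWithinAt (refl3 c₁ c₂ c₃ δ u) (fderiv ℝ u (aff δ 1 p)) {q | q.2 ≤ 0} p := by
      have h := (refl3_lower (c₁ := c₁) (c₂ := c₂) (c₃ := c₃) hδ hu p hp'.symm.le).hasFDerivWithinAt
        (s := {q | q.2 ≤ 0})
      have e : ∀ k q, q.2 = 0 → aff δ k q = aff δ 1 q := by
        intro k q hq; simp [aff, hq]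
      have e0 : ∀ q : ℝ × ℝ, q.2 = 0 → refl3 c₁ c₂ c₃ δ u q = c₁ * u (aff δ (-1) q)
          + c₂ * u (aff δ (-2) q) + c₃ * u (aff δ (-3) q) := by
        intro q hq
        rw [e (-1) q hq, e (-2) q hq, e (-3) q hq]
        simp only [refl3, hq, le_refl, if_true]
        linear_combination -(u (aff δ 1 q)) * h1
      have hc : ∀ q ∈ {q : ℝ × ℝ | q.2 ≤ 0}, refl3 c₁ c₂ c₃ δ u q = c₁ * u (aff δ (-1) q)
          + c₂ * u (aff δ (-2) q) + c₃ * u (aff δ (-3) q) := by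
        intro q hq
        rcases (show q.2 ≤ 0 from hq).lt_or_eq with h' | h'
        · simp [refl3, not_le.2 h']
        · exact e0 q h'
      have h := h.congr hc (e0 p hp'.symm)
      · rw [e (-1) p hp'.symm, e (-2) p hp'.symm, e (-3) p hp'.symm] at h
        convert! h using 1
        apply ContinuousLinearMap.ext
        intro w
        have hw : w = w.1 • ((1:ℝ), (0:ℝ)) + w.2 • ((0:ℝ), (1:ℝ)) := by ext <;> simp
        set A := fderiv ℝ u (aff δ 1 p)
        have hk : ∀ k : ℝ, A (w.1, k * w.2) = w.1 * A (1, 0) + k * w.2 * A (0, 1) := by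
          intro k
          have : (w.1, k * w.2) = w.1 • ((1:ℝ), (0:ℝ)) + (k * w.2) • ((0:ℝ), (1:ℝ)) := by
            ext <;> simp
          rw [this, map_add, map_smul, map_smul]; simp
        have h0 : A w = w.1 * A (1, 0) + w.2 * A (0, 1) := by
          have := hk 1; simpa using this
        simp only [ContinuousLinearMap.add_apply, ContinuousLinearMap.smul_apply,
          ContinuousLinearMap.comp_apply, ContinuousLinearMap.prod_apply,
          ContinuousLinearMap.coe_fst', ContinuousLinearMap.coe_snd', smul_eq_mul]
        rw [hk, hk, hk, h0]
        linear_combination (-w.1 * A (1, 0)) * h1 + (w.2 * A (0, 1)) * h2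
    have := hA.union hB
    rw [← hasFDerivWithinAt_univ]
    convert this using 1
    ext q; simp [le_total]

lemma refl3_differentiable {c₁ c₂ c₃ δ : ℝ} {u : ℝ × ℝ → ℝ} (hδ : 0 < δ)
    (h1 : c₁ + c₂ + c₃ = 1) (h2 : c₁ + 2 * c₂ + 3 * c₃ = -1)
    (hu : DifferentiableOn ℝ u {p | 0 < p.2}) : Differentiable ℝ (refl3 c₁ c₂ c₃ δ u) := by
  intro p
  rcases le_or_gt 0 p.2 with hp | hp
  · exact (refl3_fderiv_nonneg hδ h1 h2 hu p hp).differentiableAt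
  · exact (refl3_fderiv_neg hδ hu p hp).differentiableAt

lemma refl3_hasCompactSupport {c₁ c₂ c₃ δ R : ℝ} {u : ℝ × ℝ → ℝ} (hδ : 0 < δ)
    (hz : ∀ p : ℝ × ℝ, 0 < p.2 → R ≤ ‖p‖ → u p = 0) :
    HasCompactSupport (refl3 c₁ c₂ c₃ δ u) := by
  refine HasCompactSupport.intro (isCompact_closedBall (0 : ℝ × ℝ) (R + δ)) ?_
  intro p hp
  have hp : R + δ < ‖p‖ := by simpa using hp
  rw [Prod.norm_def, lt_sup_iff, Real.norm_eq_abs, Real.norm_eq_abs] at hp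
  have key : ∀ k : ℝ, 0 ≤ k * p.2 → 1 ≤ |k| → u (aff δ k p) = 0 := by
    intro k hk hk1
    apply hz
    · simp only [aff]; linarith
    · rw [Prod.norm_def, le_sup_iff, Real.norm_eq_abs, Real.norm_eq_abs]
      simp only [aff]
      rcases hp with h | h
      · left; linarith
      · right
        rw [abs_of_nonneg (by linarith)]
        have : k * p.2 = |k| * |p.2| := by rw [← abs_mul, abs_of_nonneg hk]
        rw [this]
        nlinarith [abs_nonneg p.2]
  rcases le_or_gt 0 p.2 with h | h
  · simp only [refl3, h, if_true]
    exact key 1 (by linarith) (by simp)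
  · simp only [refl3, not_le.2 h, if_false]
    rw [key (-1) (by linarith) (by simp), key (-2) (by linarith) (by norm_num [abs]),
      key (-3) (by linarith) (by norm_num [abs])]
    simp

lemma refl3_partials_nonneg {c₁ c₂ c₃ δ : ℝ} {u : ℝ × ℝ → ℝ} (hδ : 0 < δ)
    (h1 : c₁ + c₂ + c₃ = 1) (h2 : c₁ + 2 * c₂ + 3 * c₃ = -1)
    (hu : DifferentiableOn ℝ u {p | 0 < p.2}) (p : ℝ × ℝ) (hp : 0 ≤ p.2) (w : ℝ × ℝ) :
    fderiv ℝ (refl3 c₁ c₂ c₃ δ u) p w = fderiv ℝ u (aff δ 1 p) w := by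
  rw [(refl3_fderiv_nonneg hδ h1 h2 hu p hp).fderiv]

lemma refl3_partial1_neg {c₁ c₂ c₃ δ : ℝ} {u : ℝ × ℝ → ℝ} (hδ : 0 < δ)
    (hu : DifferentiableOn ℝ u {p | 0 < p.2}) (p : ℝ × ℝ) (hp : p.2 < 0) :
    fderiv ℝ (refl3 c₁ c₂ c₃ δ u) p (1, 0) = c₁ * fderiv ℝ u (aff δ (-1) p) (1, 0)
      + c₂ * fderiv ℝ u (aff δ (-2) p) (1, 0) + c₃ * fderiv ℝ u (aff δ (-3) p) (1, 0) := by
  rw [(refl3_fderiv_neg hδ hu p hp).fderiv]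
  simp

lemma refl3_partial2_neg {c₁ c₂ c₃ δ : ℝ} {u : ℝ × ℝ → ℝ} (hδ : 0 < δ)
    (hu : DifferentiableOn ℝ u {p | 0 < p.2}) (p : ℝ × ℝ) (hp : p.2 < 0) :
    fderiv ℝ (refl3 c₁ c₂ c₃ δ u) p (0, 1) = -c₁ * fderiv ℝ u (aff δ (-1) p) (0, 1)
      + (-2 * c₂) * fderiv ℝ u (aff δ (-2) p) (0, 1)
      + (-3 * c₃) * fderiv ℝ u (aff δ (-3) p) (0, 1) := by
  rw [(refl3_fderiv_neg hδ hu p hp).fderiv]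
  have hk : ∀ (A : ℝ × ℝ →L[ℝ] ℝ) (k : ℝ), A (0, k) = k * A (0, 1) := by
    intro A k
    have : ((0:ℝ), k) = k • ((0:ℝ), (1:ℝ)) := by ext <;> simp
    rw [this, map_smul, smul_eq_mul]
  simp only [ContinuousLinearMap.add_apply, ContinuousLinearMap.smul_apply,
          ContinuousLinearMap.comp_apply, ContinuousLinearMap.prod_apply,
          ContinuousLinearMap.coe_fst', ContinuousLinearMap.coe_snd', smul_eq_mul, mul_one]
  rw [hk _ (-1), hk _ (-2), hk _ (-3)]
  ring

/-- Squared gradient density of a pair. -/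
def gD (u v : ℝ × ℝ → ℝ) (p : ℝ × ℝ) : ℝ :=
  fderiv ℝ u p (1, 0) ^ 2 + fderiv ℝ u p (0, 1) ^ 2 + fderiv ℝ v p (1, 0) ^ 2
    + fderiv ℝ v p (0, 1) ^ 2

/-- Squared symmetric gradient density of a pair. -/
def sD (u v : ℝ × ℝ → ℝ) (p : ℝ × ℝ) : ℝ :=
  2 * fderiv ℝ u p (1, 0) ^ 2 + 2 * fderiv ℝ v p (0, 1) ^ 2
    + (fderiv ℝ u p (0, 1) + fderiv ℝ v p (1, 0)) ^ 2

lemma measurable_gD (u v : ℝ × ℝ → ℝ) : Measurable (gD u v) := by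
  unfold gD
  have h : ∀ (f : ℝ × ℝ → ℝ) w, Measurable (fun p => fderiv ℝ f p w) := fun f w =>
    measurable_fderiv_apply_const ℝ f w
  exact ((((h u _).pow_const 2).add ((h u _).pow_const 2)).add ((h v _).pow_const 2)).add
    ((h v _).pow_const 2)

lemma measurable_sD (u v : ℝ × ℝ → ℝ) : Measurable (sD u v) := by
  unfold sD
  have h : ∀ (f : ℝ × ℝ → ℝ) w, Measurable (fun p => fderiv ℝ f p w) := fun f w =>
    measurable_fderiv_apply_const ℝ f w
  exact ((((h u _).pow_const 2).const_mul 2).add (((h v _).pow_const 2).const_mul 2)).add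
    (((h u _).add (h v _)).pow_const 2)

lemma gD_nonneg (u v : ℝ × ℝ → ℝ) (p) : 0 ≤ gD u v p := by unfold gD; positivity
lemma sD_nonneg (u v : ℝ × ℝ → ℝ) (p) : 0 ≤ sD u v p := by unfold sD; positivity

lemma cs3 (x y z : ℝ) : (x + y + z) ^ 2 ≤ 3 * (x ^ 2 + y ^ 2 + z ^ 2) := by
  nlinarith [sq_nonneg (x - y), sq_nonneg (y - z), sq_nonneg (x - z)]

lemma refl_bound (δ : ℝ) (F : ℝ × ℝ → ℝ) (hF : Measurable F) (hF0 : ∀ p, 0 ≤ F p)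
    (Z : ℝ × ℝ → ℝ) (M : ℝ) (hM : 0 ≤ M) (hδ : 0 < δ)
    (hup : ∀ p : ℝ × ℝ, 0 ≤ p.2 → Z p ≤ M * F (aff δ 1 p))
    (hlo : ∀ p : ℝ × ℝ, p.2 < 0 → Z p ≤ M * (F (aff δ (-1) p) + F (aff δ (-2) p)
      + F (aff δ (-3) p))) :
    ∫⁻ p, ENNReal.ofReal (Z p) ≤
      ENNReal.ofReal (4 * M) * ∫⁻ p in {p : ℝ × ℝ | 0 < p.2}, ENNReal.ofReal (F p) := by
  have hH : MeasurableSet {p : ℝ × ℝ | 0 < p.2} := measurableSet_lt measurable_const measurable_snd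
  set g : ℝ × ℝ → ℝ≥0∞ := {p : ℝ × ℝ | 0 < p.2}.indicator (fun p => ENNReal.ofReal (F p)) with hg
  have hgm : Measurable g := (hF.ennreal_ofReal).indicator hH
  have hgeq : ∀ p : ℝ × ℝ, 0 < p.2 → g p = ENNReal.ofReal (F p) := by
    intro p hp; exact indicator_of_mem (show p ∈ {p : ℝ × ℝ | 0 < p.2} from hp) _
  have hpt : ∀ p, ENNReal.ofReal (Z p) ≤ ENNReal.ofReal M * (g (aff δ 1 p) + g (aff δ (-1) p)
      + g (aff δ (-2) p) + g (aff δ (-3) p)) := by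
    intro p
    rcases le_or_gt 0 p.2 with h | h
    · calc _ ≤ ENNReal.ofReal (M * F (aff δ 1 p)) := ENNReal.ofReal_le_ofReal (hup p h)
        _ = ENNReal.ofReal M * g (aff δ 1 p) := by
            rw [ENNReal.ofReal_mul hM, hgeq _ (by simp only [aff]; linarith)]
        _ ≤ _ := by
            gcongr
            rw [add_assoc, add_assoc]; exact le_self_add
    · calc _ ≤ ENNReal.ofReal (M * (F (aff δ (-1) p) + F (aff δ (-2) p)
              + F (aff δ (-3) p))) := ENNReal.ofReal_le_ofReal (hlo p h)
        _ = ENNReal.ofReal M * (g (aff δ (-1) p) + g (aff δ (-2) p) + g (aff δ (-3) p)) := by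
            rw [ENNReal.ofReal_mul hM, ENNReal.ofReal_add (add_nonneg (hF0 _) (hF0 _)) (hF0 _),
              ENNReal.ofReal_add (hF0 _) (hF0 _), hgeq _ (by simp only [aff]; linarith),
              hgeq _ (by simp only [aff]; linarith), hgeq _ (by simp only [aff]; linarith)]
        _ ≤ _ := by
            gcongr
            exact le_add_self
  have hma : ∀ k, Measurable (fun p => g (aff δ k p)) := fun k => hgm.comp (measurable_aff δ k)
  calc _ ≤ ∫⁻ p, ENNReal.ofReal M * (g (aff δ 1 p) + g (aff δ (-1) p)
      + g (aff δ (-2) p) + g (aff δ (-3) p)) := lintegral_mono hpt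
    _ = ENNReal.ofReal M * ((∫⁻ p, g (aff δ 1 p)) + (∫⁻ p, g (aff δ (-1) p))
      + (∫⁻ p, g (aff δ (-2) p)) + (∫⁻ p, g (aff δ (-3) p))) := by
        have hm4 : Measurable (fun p => g (aff δ 1 p) + g (aff δ (-1) p)
            + g (aff δ (-2) p) + g (aff δ (-3) p)) :=
          (((hma 1).add (hma (-1))).add (hma (-2))).add (hma (-3))
        rw [lintegral_const_mul _ hm4,
          lintegral_add_right _ (hma _), lintegral_add_right _ (hma _),
          lintegral_add_right _ (hma _)]
    _ ≤ ENNReal.ofReal M * ((∫⁻ p, g p) + (∫⁻ p, g p) + (∫⁻ p, g p) + (∫⁻ p, g p)) := by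
        have hl : ∀ k : ℝ, 1 ≤ |k| → ∫⁻ p, g (aff δ k p) ≤ ∫⁻ p, g p := fun k hk =>
          lintegral_aff_le δ k hk g hgm
        have h1 := hl 1 (by norm_num)
        have h2 := hl (-1) (by norm_num)
        have h3 := hl (-2) (by norm_num [abs])
        have h4 := hl (-3) (by norm_num [abs])
        exact mul_le_mul_right (add_le_add (add_le_add (add_le_add h1 h2) h3) h4) _
    _ = ENNReal.ofReal (4 * M) * ∫⁻ p, g p := by
        rw [ENNReal.ofReal_mul (by norm_num)]
        norm_num; ring
    _ = _ := by rw [hg, lintegral_indicator hH]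

lemma memLp_of_sq_le {f : ℝ × ℝ → ℝ} {G : ℝ × ℝ → ℝ} (hf : Measurable f)
    (hle : ∀ p, f p ^ 2 ≤ G p) (hG : ∫⁻ p, ENNReal.ofReal (G p) < ∞) : MemLp f 2 volume := by
  rw [memLp_two_iff_integrable_sq hf.aestronglyMeasurable]
  refine ⟨(hf.pow_const 2).aestronglyMeasurable, ?_⟩
  rw [hasFiniteIntegral_iff_ofReal (ae_of_all _ fun p => sq_nonneg _)]
  exact (lintegral_mono fun p => ENNReal.ofReal_le_ofReal (hle p)).trans_lt hG

lemma half_korn_delta {u v : ℝ × ℝ → ℝ} {R : ℝ}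
    (hu : DifferentiableOn ℝ u {p | 0 < p.2}) (hv : DifferentiableOn ℝ v {p | 0 < p.2})
    (hzu : ∀ p : ℝ × ℝ, 0 < p.2 → R ≤ ‖p‖ → u p = 0)
    (hfin : ∫⁻ p in {p : ℝ × ℝ | 0 < p.2}, ENNReal.ofReal (gD u v p) < ∞) (δ : ℝ) (hδ : 0 < δ) :
    ∫⁻ p in {p : ℝ × ℝ | δ < p.2}, ENNReal.ofReal (gD u v p) ≤
      ENNReal.ofReal 25000 * ∫⁻ p in {p : ℝ × ℝ | 0 < p.2}, ENNReal.ofReal (sD u v p) := by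
  set U := refl3 6 (-8) 3 δ u with hU
  set V := refl3 (-6) 16 (-9) δ v with hV
  have dU : Differentiable ℝ U := refl3_differentiable hδ (by norm_num) (by norm_num) hu
  have dV : Differentiable ℝ V := refl3_differentiable hδ (by norm_num) (by norm_num) hv
  have cU : HasCompactSupport U := refl3_hasCompactSupport hδ hzu
  have hupU : ∀ p : ℝ × ℝ, 0 ≤ p.2 → ∀ w, fderiv ℝ U p w = fderiv ℝ u (aff δ 1 p) w :=
    fun p hp w => refl3_partials_nonneg hδ (by norm_num) (by norm_num) hu p hp w
  have hupV : ∀ p : ℝ × ℝ, 0 ≤ p.2 → ∀ w, fderiv ℝ V p w = fderiv ℝ v (aff δ 1 p) w :=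
    fun p hp w => refl3_partials_nonneg hδ (by norm_num) (by norm_num) hv p hp w
  have hg := refl_bound δ (gD u v) (measurable_gD u v) (gD_nonneg u v) (gD U V) 6144 (by norm_num)
    hδ (by
      intro p hp
      have h0 := gD_nonneg u v (aff δ 1 p)
      have : gD U V p = gD u v (aff δ 1 p) := by
        simp only [gD, hupU p hp, hupV p hp]
      rw [this]; linarith) (by
      intro p hp
      simp only [gD]
      rw [refl3_partial1_neg hδ hu p hp, refl3_partial2_neg hδ hu p hp,
        refl3_partial1_neg hδ hv p hp, refl3_partial2_neg hδ hv p hp]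
      refine (add_le_add (add_le_add (add_le_add (cs3 _ _ _) (cs3 _ _ _)) (cs3 _ _ _))
        (cs3 _ _ _)).trans ?_
      simp only [mul_pow]
      linarith [sq_nonneg (fderiv ℝ u (aff δ (-1) p) (1, 0)),
        sq_nonneg (fderiv ℝ u (aff δ (-2) p) (1, 0)), sq_nonneg (fderiv ℝ u (aff δ (-3) p) (1, 0)),
        sq_nonneg (fderiv ℝ u (aff δ (-1) p) (0, 1)), sq_nonneg (fderiv ℝ u (aff δ (-2) p) (0, 1)),
        sq_nonneg (fderiv ℝ u (aff δ (-3) p) (0, 1)), sq_nonneg (fderiv ℝ v (aff δ (-1) p) (1, 0)),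
        sq_nonneg (fderiv ℝ v (aff δ (-2) p) (1, 0)), sq_nonneg (fderiv ℝ v (aff δ (-3) p) (1, 0)),
        sq_nonneg (fderiv ℝ v (aff δ (-1) p) (0, 1)), sq_nonneg (fderiv ℝ v (aff δ (-2) p) (0, 1)),
        sq_nonneg (fderiv ℝ v (aff δ (-3) p) (0, 1))])
  have hs := refl_bound δ (sD u v) (measurable_sD u v) (sD_nonneg u v) (sD U V) 6144 (by norm_num)
    hδ (by
      intro p hp
      have h0 := sD_nonneg u v (aff δ 1 p)
      have : sD U V p = sD u v (aff δ 1 p) := by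
        simp only [sD, hupU p hp, hupV p hp]
      rw [this]; linarith) (by
      intro p hp
      simp only [sD]
      rw [refl3_partial1_neg hδ hu p hp, refl3_partial2_neg hδ hu p hp,
        refl3_partial1_neg hδ hv p hp, refl3_partial2_neg hδ hv p hp]
      have e1 := cs3 (6 * fderiv ℝ u (aff δ (-1) p) (1, 0)) (-8 * fderiv ℝ u (aff δ (-2) p) (1, 0))
        (3 * fderiv ℝ u (aff δ (-3) p) (1, 0))
      have e2 := cs3 (-(-6) * fderiv ℝ v (aff δ (-1) p) (0, 1))
        (-2 * 16 * fderiv ℝ v (aff δ (-2) p) (0, 1)) (-3 * -9 * fderiv ℝ v (aff δ (-3) p) (0, 1))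
      have e3 := cs3
        (-6 * (fderiv ℝ u (aff δ (-1) p) (0, 1) + fderiv ℝ v (aff δ (-1) p) (1, 0)))
        (16 * (fderiv ℝ u (aff δ (-2) p) (0, 1) + fderiv ℝ v (aff δ (-2) p) (1, 0)))
        (-9 * (fderiv ℝ u (aff δ (-3) p) (0, 1) + fderiv ℝ v (aff δ (-3) p) (1, 0)))
      have e4 : -6 * (fderiv ℝ u (aff δ (-1) p) (0, 1) + fderiv ℝ v (aff δ (-1) p) (1, 0)) +
        16 * (fderiv ℝ u (aff δ (-2) p) (0, 1) + fderiv ℝ v (aff δ (-2) p) (1, 0)) +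
        -9 * (fderiv ℝ u (aff δ (-3) p) (0, 1) + fderiv ℝ v (aff δ (-3) p) (1, 0)) =
        -6 * fderiv ℝ u (aff δ (-1) p) (0, 1) + -2 * -8 * fderiv ℝ u (aff δ (-2) p) (0, 1) +
            -3 * 3 * fderiv ℝ u (aff δ (-3) p) (0, 1) +
          (-6 * fderiv ℝ v (aff δ (-1) p) (1, 0) + 16 * fderiv ℝ v (aff δ (-2) p) (1, 0) +
            -9 * fderiv ℝ v (aff δ (-3) p) (1, 0)) := by ring
      rw [e4] at e3
      simp only [mul_pow (_ : ℝ) (fderiv ℝ _ _ _), mul_pow (_ : ℝ) (_ + _)] at e1 e2 e3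
      linarith [sq_nonneg (fderiv ℝ u (aff δ (-1) p) (1, 0)),
        sq_nonneg (fderiv ℝ u (aff δ (-2) p) (1, 0)), sq_nonneg (fderiv ℝ u (aff δ (-3) p) (1, 0)),
        sq_nonneg (fderiv ℝ v (aff δ (-1) p) (0, 1)), sq_nonneg (fderiv ℝ v (aff δ (-2) p) (0, 1)),
        sq_nonneg (fderiv ℝ v (aff δ (-3) p) (0, 1)),
        sq_nonneg (fderiv ℝ u (aff δ (-1) p) (0, 1) + fderiv ℝ v (aff δ (-1) p) (1, 0)),
        sq_nonneg (fderiv ℝ u (aff δ (-2) p) (0, 1) + fderiv ℝ v (aff δ (-2) p) (1, 0)),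
        sq_nonneg (fderiv ℝ u (aff δ (-3) p) (0, 1) + fderiv ℝ v (aff δ (-3) p) (1, 0))])
  have hgfin : ∫⁻ p, ENNReal.ofReal (gD U V p) < ∞ :=
    hg.trans_lt (ENNReal.mul_lt_top ENNReal.ofReal_lt_top hfin)
  have mU : ∀ w, Measurable (fun p => fderiv ℝ U p w) := fun w =>
    measurable_fderiv_apply_const ℝ U w
  have mV : ∀ w, Measurable (fun p => fderiv ℝ V p w) := fun w =>
    measurable_fderiv_apply_const ℝ V w
  have l1 := memLp_of_sq_le (mU (1, 0)) (G := gD U V) (fun p => by unfold gD; nlinarith [sq_nonneg (fderiv ℝ U p (0, 1)), sq_nonneg (fderiv ℝ V p (0, 1)), sq_nonneg (fderiv ℝ V p (1, 0))]) hgfin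
  have l2 := memLp_of_sq_le (mU (0, 1)) (G := gD U V) (fun p => by unfold gD; nlinarith [sq_nonneg (fderiv ℝ U p (1, 0)), sq_nonneg (fderiv ℝ V p (0, 1)), sq_nonneg (fderiv ℝ V p (1, 0))]) hgfin
  have l3 := memLp_of_sq_le (mV (1, 0)) (G := gD U V) (fun p => by unfold gD; nlinarith [sq_nonneg (fderiv ℝ U p (0, 1)), sq_nonneg (fderiv ℝ V p (0, 1)), sq_nonneg (fderiv ℝ U p (1, 0))]) hgfin
  have l4 := memLp_of_sq_le (mV (0, 1)) (G := gD U V) (fun p => by unfold gD; nlinarith [sq_nonneg (fderiv ℝ U p (0, 1)), sq_nonneg (fderiv ℝ U p (1, 0)), sq_nonneg (fderiv ℝ V p (1, 0))]) hgfin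
  have pk := plane_korn (μ := volume) dU dV cU l1 l2 l3 l4
  have iG : Integrable (gD U V) volume :=
    ((l1.integrable_sq.add l2.integrable_sq).add l3.integrable_sq).add l4.integrable_sq
  have iS : Integrable (sD U V) volume :=
    ((l1.integrable_sq.const_mul 2).add (l4.integrable_sq.const_mul 2)).add
      (l2.add l3).integrable_sq
  have pk' : ∫⁻ p, ENNReal.ofReal (gD U V p) ≤ ∫⁻ p, ENNReal.ofReal (sD U V p) := by
    rw [← ofReal_integral_eq_lintegral_ofReal iG (ae_of_all _ (gD_nonneg U V)),
      ← ofReal_integral_eq_lintegral_ofReal iS (ae_of_all _ (sD_nonneg U V))]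
    exact ENNReal.ofReal_le_ofReal pk
  have hδm : MeasurableSet {p : ℝ × ℝ | δ < p.2} := measurableSet_lt measurable_const measurable_snd
  set g : ℝ × ℝ → ℝ≥0∞ := {p : ℝ × ℝ | δ < p.2}.indicator (fun p => ENNReal.ofReal (gD u v p))
    with hgdef
  have hgm : Measurable g := ((measurable_gD u v).ennreal_ofReal).indicator hδm
  have hlow : ∫⁻ p, g p ≤ ∫⁻ p, ENNReal.ofReal (gD U V p) := by
    have := lintegral_aff δ 1 one_ne_zero g hgm
    simp only [inv_one, abs_one, ENNReal.ofReal_one, one_mul] at this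
    rw [← this]
    refine lintegral_mono fun p => ?_
    by_cases hp : 0 < p.2
    · have : gD U V p = gD u v (aff δ 1 p) := by
        simp only [gD, hupU p hp.le, hupV p hp.le]
      rw [this]
      exact indicator_le_self _ _ _
    · rw [hgdef, indicator_of_notMem]
      · simp
      · intro h
        have h : δ < 1 * p.2 + δ := h
        exact hp (by linarith)
  rw [← lintegral_indicator hδm]
  calc _ ≤ _ := hlow
    _ ≤ _ := pk'
    _ ≤ _ := hs
    _ ≤ _ := by gcongr; norm_num

lemma half_korn {u v : ℝ × ℝ → ℝ} {R : ℝ}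
    (hu : DifferentiableOn ℝ u {p | 0 < p.2}) (hv : DifferentiableOn ℝ v {p | 0 < p.2})
    (hzu : ∀ p : ℝ × ℝ, 0 < p.2 → R ≤ ‖p‖ → u p = 0)
    (hfin : ∫⁻ p in {p : ℝ × ℝ | 0 < p.2}, ENNReal.ofReal (gD u v p) < ∞) :
    ∫⁻ p in {p : ℝ × ℝ | 0 < p.2}, ENNReal.ofReal (gD u v p) ≤
      ENNReal.ofReal 25000 * ∫⁻ p in {p : ℝ × ℝ | 0 < p.2}, ENNReal.ofReal (sD u v p) := by
  have hun : {p : ℝ × ℝ | 0 < p.2} = ⋃ n : ℕ, {p : ℝ × ℝ | 1 / ((n : ℝ) + 1) < p.2} := by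
    ext p
    simp only [mem_iUnion]
    constructor
    · intro h
      exact exists_nat_one_div_lt (show 0 < p.2 from h)
    · rintro ⟨n, hn⟩
      have hn : 1 / ((n : ℝ) + 1) < p.2 := hn
      exact (by positivity : 0 < 1 / ((n : ℝ) + 1)).trans hn
  conv_lhs => rw [hun]
  rw [setLIntegral_iUnion_of_directed]
  · exact iSup_le fun n => half_korn_delta hu hv hzu hfin _ (by positivity)
  · refine Monotone.directed_le ?_
    intro m n hmn p hp
    have hp : 1 / ((m : ℝ) + 1) < p.2 := hp
    exact (one_div_le_one_div_of_le (by positivity) (by gcongr)).trans_lt hp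

lemma ubc_normal {Ω : Set E2} {r : ℝ} (h : IsUBCWith Ω r) {x : E2} (hx : x ∈ frontier Ω) :
    ∃ n : E2, ‖n‖ = 1 ∧ ball (x + r • n) r ⊆ Ω ∧ ball (x - r • n) r ⊆ Ωᶜ := by
  obtain ⟨hr, h⟩ := h
  obtain ⟨a, b, ha, hb, hab⟩ := h x hx
  have hx' : x ∈ sphere a r ∩ sphere b r := by rw [hab]; rfl
  have h1 : ‖x - a‖ = r := by simpa [dist_eq_norm] using hx'.1
  have h2 : ‖x - b‖ = r := by simpa [dist_eq_norm] using hx'.2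
  have hy : a + b - x ∈ sphere a r ∩ sphere b r := by
    constructor
    · rw [mem_sphere, dist_eq_norm, ← h2, ← norm_neg]; congr 1; abel
    · rw [mem_sphere, dist_eq_norm, ← h1, ← norm_neg]; congr 1; abel
  rw [hab, mem_singleton_iff] at hy
  refine ⟨r⁻¹ • (a - x), ?_, ?_, ?_⟩
  · rw [norm_smul, norm_sub_rev, h1, norm_inv, Real.norm_of_nonneg hr.le, inv_mul_cancel₀ hr.ne']
  · rw [smul_inv_smul₀ hr.ne', add_sub_cancel]; exact ha
  · rw [smul_inv_smul₀ hr.ne']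
    have : x - (a - x) = b := by
      rw [sub_sub_eq_add_sub, sub_eq_iff_eq_add]; nth_rewrite 1 [← hy]; abel
    rw [this]; exact hb

lemma disj_ball_frontier {Ω : Set E2} (ho : IsOpen Ω) {c : E2} {r : ℝ} 
    (h : ball c r ⊆ Ω ∨ ball c r ⊆ Ωᶜ) {q : E2} (hq : q ∈ frontier Ω) : r ≤ ‖q - c‖ := by
  by_contra hlt
  push Not at hlt
  have hb : q ∈ ball c r := by rw [mem_ball, dist_eq_norm]; exact hlt
  rcases h with h | h
  · rw [ho.frontier_eq] at hq
    exact hq.2 (h hb)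
  · have : q ∈ interior Ωᶜ := interior_maximal h isOpen_ball hb
    rw [interior_compl] at this
    exact this (frontier_subset_closure hq)

lemma tangent_est {Ω : Set E2} (ho : IsOpen Ω) {r : ℝ} (hr : 0 < r) {y n q : E2} (hn : ‖n‖ = 1)
    (h1 : ball (y + r • n) r ⊆ Ω) (h2 : ball (y - r • n) r ⊆ Ωᶜ) (hq : q ∈ frontier Ω) :
    |⟪q - y, n⟫| * (2 * r) ≤ ‖q - y‖ ^ 2 := by
  have e1 := disj_ball_frontier ho (Or.inl h1) hq
  have e2 := disj_ball_frontier ho (Or.inr h2) hq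
  have e1' : r ^ 2 ≤ ‖q - (y + r • n)‖ ^ 2 := by gcongr
  have e2' : r ^ 2 ≤ ‖q - (y - r • n)‖ ^ 2 := by gcongr
  rw [show q - (y + r • n) = (q - y) - r • n by abel, norm_sub_sq_real, inner_smul_right,
    norm_smul, hn, Real.norm_of_nonneg hr.le] at e1'
  rw [show q - (y - r • n) = (q - y) + r • n by abel, norm_add_sq_real, inner_smul_right,
    norm_smul, hn, Real.norm_of_nonneg hr.le] at e2'
  rcases abs_cases ⟪q - y, n⟫ with ⟨h, _⟩ | ⟨h, _⟩ <;> rw [h] <;> nlinarith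

lemma ball_sep {c d : E2} {r : ℝ} (hr : 0 < r) (h : Disjoint (ball c r) (ball d r)) :
    2 * r ≤ ‖c - d‖ := by
  by_contra hlt
  push Not at hlt
  have hh := Set.disjoint_left.1 h
  refine @hh (midpoint ℝ c d) ?_ ?_
  · rw [mem_ball, dist_midpoint_left, dist_eq_norm]; norm_num; linarith
  · rw [mem_ball, dist_midpoint_right, dist_eq_norm]; norm_num; linarith

lemma normal_est {Ω : Set E2} {r : ℝ} (hr : 0 < r) {x n y m : E2} (hn : ‖n‖ = 1) (hm : ‖m‖ = 1)
    (h1 : ball (x + r • n) r ⊆ Ω) (h2 : ball (x - r • n) r ⊆ Ωᶜ)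
    (h3 : ball (y + r • m) r ⊆ Ω) (h4 : ball (y - r • m) r ⊆ Ωᶜ) :
    r * ‖m - n‖ ≤ ‖y - x‖ := by
  have d1 : 2 * r ≤ ‖(y + r • m) - (x - r • n)‖ := ball_sep hr
    (Set.disjoint_of_subset h3 h2 disjoint_compl_right)
  have d2 : 2 * r ≤ ‖(y - r • m) - (x + r • n)‖ := ball_sep hr
    (Set.disjoint_of_subset h4 h1 disjoint_compl_left)
  have d1' : (2 * r) ^ 2 ≤ ‖(y + r • m) - (x - r • n)‖ ^ 2 := by gcongr
  have d2' : (2 * r) ^ 2 ≤ ‖(y - r • m) - (x + r • n)‖ ^ 2 := by gcongr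
  rw [show (y + r • m) - (x - r • n) = (y - x) + r • (m + n) by module, norm_add_sq_real] at d1'
  rw [show (y - r • m) - (x + r • n) = (y - x) - r • (m + n) by module, norm_sub_sq_real] at d2'
  rw [norm_smul, mul_pow _ ‖m + n‖, Real.norm_of_nonneg hr.le, norm_add_sq_real, hn, hm] at d1' d2'
  refine abs_le_of_sq_le_sq' ?_ (norm_nonneg _) |>.2
  rw [mul_pow, norm_sub_sq_real, hn, hm]
  nlinarith

lemma seg_mem {Ω : Set E2} (ho : IsOpen Ω) {γ : ℝ → E2} (hγ : Continuous γ) {a b : ℝ} 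
    (h : ∀ s ∈ uIcc a b, γ s ∉ frontier Ω) (ha : γ a ∈ Ω) : γ b ∈ Ω := by
  have hp : IsPreconnected (γ '' uIcc a b) := isPreconnected_uIcc.image _ hγ.continuousOn
  have := hp.subset_left_of_subset_union ho isClosed_closure.isOpen_compl
    (Set.disjoint_compl_right_iff_subset.2 subset_closure) (by
      rintro _ ⟨s, hs, rfl⟩
      by_cases h' : γ s ∈ closure Ω
      · left
        by_contra h''
        exact h s hs (by rw [ho.frontier_eq]; exact ⟨h', h''⟩)
      · exact Or.inr h') ⟨γ a, mem_image_of_mem _ left_mem_uIcc, ha⟩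
  exact this (mem_image_of_mem _ right_mem_uIcc)

/-- local frame map -/
def frm (x τ n : E2) (t s : ℝ) : E2 := x + (t • τ + s • n)

lemma norm_comb {τ n : E2} (hτ : ‖τ‖ = 1) (hn : ‖n‖ = 1) (h : ⟪τ, n⟫ = 0) (t s : ℝ) :
    ‖t • τ + s • n‖ ^ 2 = t ^ 2 + s ^ 2 := by
  rw [norm_add_sq_real, inner_smul_left, inner_smul_right, h, norm_smul, norm_smul, hτ, hn]
  simp

lemma exists_tangent {n : E2} (hn : ‖n‖ = 1) : ∃ τ : E2, ‖τ‖ = 1 ∧ ⟪τ, n⟫ = 0 := by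
  refine ⟨!₂[-n 1, n 0], ?_, ?_⟩
  · rw [← hn, EuclideanSpace.norm_eq, EuclideanSpace.norm_eq]
    congr 1
    simp [Fin.sum_univ_two]; ring
  · simp [PiLp.inner_apply, Fin.sum_univ_two]; ring

lemma local_graph {Ω : Set E2} (ho : IsOpen Ω) {l : ℝ} (hU : IsUBCWith Ω (10000 * l)) {x : E2}
    (hx : x ∈ frontier Ω) : ∃ (τ n : E2) (f f' : ℝ → ℝ), ‖τ‖ = 1 ∧ ‖n‖ = 1 ∧ ⟪τ, n⟫ = 0 ∧
      Measurable f ∧ (∀ t, |t| < l → HasDerivAt f (f' t) t ∧ |f' t| ≤ 1 / 1000) ∧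
      (∀ t, |t| < l → |f t| ≤ l) ∧
      (∀ t s, |t| < l → |s| < l → (frm x τ n t s ∈ Ω ↔ f t < s)) := by
  obtain ⟨n, hn, hin, hout⟩ := ubc_normal hU hx
  obtain ⟨τ, hτ, hτn⟩ := exists_tangent hn
  have hl : 0 < l := by have := hU.1; linarith
  have hr := hU.1
  have hcont : ∀ t, Continuous (frm x τ n t) := by intro t; unfold frm; fun_prop
  have hnc := norm_comb hτ hn hτn
  -- top and bottom
  have htop : ∀ t, |t| ≤ l → frm x τ n t l ∈ Ω := by
    intro t ht
    apply hin
    rw [mem_ball, dist_eq_norm]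
    have : frm x τ n t l - (x + (10000 * l) • n) = t • τ + (l - 10000 * l) • n := by
      unfold frm; module
    rw [this]
    refine lt_of_pow_lt_pow_left₀ 2 hr.le ?_
    rw [hnc]
    have := sq_le_sq' (abs_le.1 ht).1 (abs_le.1 ht).2
    nlinarith
  have hbot : ∀ t, |t| ≤ l → frm x τ n t (-l) ∉ Ω := by
    intro t ht
    apply hout
    rw [mem_ball, dist_eq_norm]
    have : frm x τ n t (-l) - (x - (10000 * l) • n) = t • τ + (-l + 10000 * l) • n := by
      unfold frm; module
    rw [this]
    refine lt_of_pow_lt_pow_left₀ 2 hr.le ?_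
    rw [hnc]
    have := sq_le_sq' (abs_le.1 ht).1 (abs_le.1 ht).2
    nlinarith
  have hex : ∀ t, |t| ≤ l → ∃ s, |s| ≤ l ∧ frm x τ n t s ∈ frontier Ω := by
    intro t ht
    by_contra hne
    push Not at hne
    refine hbot t ht (seg_mem ho (hcont t) (a := l) (b := -l) ?_ (htop t ht))
    intro s hs
    rw [uIcc_of_ge (by linarith)] at hs
    exact hne s (abs_le.2 hs)
  -- comparison
  have hcmp : ∀ t s, |t| ≤ l → |s| ≤ l → frm x τ n t s ∈ frontier Ω → ∃ α β : ℝ,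
      |α| ≤ 1 / 5000 ∧ |β - 1| ≤ 1 / 5000 ∧ ∀ t' s', frm x τ n t' s' ∈ frontier Ω →
        |(t' - t) * α + (s' - s) * β| * (20000 * l) ≤ (t' - t) ^ 2 + (s' - s) ^ 2 := by
    intro t s ht hs hy
    obtain ⟨m, hm, him, hom⟩ := ubc_normal hU hy
    have h1 := normal_est hr hn hm hin hout him hom
    have h2 : ‖frm x τ n t s - x‖ ≤ 2 * l := by
      rw [show frm x τ n t s - x = t • τ + s • n by unfold frm; abel]
      refine (norm_add_le _ _).trans ?_
      rw [norm_smul, norm_smul, hτ, hn, Real.norm_eq_abs, Real.norm_eq_abs]; linarith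
    have h3 : ‖m - n‖ ≤ 1 / 5000 := by
      have : 10000 * l * ‖m - n‖ ≤ 10000 * l * (1 / 5000) := by linarith
      exact le_of_mul_le_mul_left this hr
    refine ⟨⟪τ, m⟫, ⟪n, m⟫, ?_, ?_, ?_⟩
    · have : ⟪τ, m⟫ = ⟪τ, m - n⟫ := by rw [inner_sub_right, hτn, sub_zero]
      rw [this]
      refine (abs_real_inner_le_norm _ _).trans ?_
      rw [hτ, one_mul]; exact h3
    · have : ⟪n, m⟫ - 1 = ⟪n, m - n⟫ := by
        rw [inner_sub_right, real_inner_self_eq_norm_sq, hn]; norm_num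
      rw [this]
      refine (abs_real_inner_le_norm _ _).trans ?_
      rw [hn, one_mul]; exact h3
    · intro t' s' hq
      have := tangent_est ho hr hm him hom hq
      rw [show frm x τ n t' s' - frm x τ n t s = (t' - t) • τ + (s' - s) • n by unfold frm; module,
        hnc, inner_add_left, inner_smul_left, inner_smul_left] at this
      simp only [conj_trivial] at this
      linarith
  -- Lipschitz
  have hlip : ∀ t s t' s', |t| ≤ l → |s| ≤ l → |t'| ≤ l → |s'| ≤ l → frm x τ n t s ∈ frontier Ω →
      frm x τ n t' s' ∈ frontier Ω → |s' - s| ≤ |t' - t| := by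
    intro t s t' s' ht hs ht' hs' hy hq
    obtain ⟨α, β, hα, hβ, h⟩ := hcmp t s ht hs hy
    have h := h t' s' hq
    set a := t' - t
    set b := s' - s
    have ha : |a| ≤ 2 * l := (abs_sub _ _).trans (by linarith)
    have hb : |b| ≤ 2 * l := (abs_sub _ _).trans (by linarith)
    have h4 : |b| * β ≤ |a * α + b * β| + |a| * |α| := by
      have hβ0 : 0 ≤ β := by linarith [(abs_le.1 hβ).1]
      calc |b| * β = |b * β| := by rw [abs_mul, abs_of_nonneg hβ0]
        _ = |(a * α + b * β) - a * α| := by ring_nf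
        _ ≤ _ := by rw [← abs_mul]; exact abs_sub _ _
    have h5 : a ^ 2 ≤ |a| * (2 * l) := by rw [← sq_abs, sq]; gcongr
    have h6 : b ^ 2 ≤ |b| * (2 * l) := by rw [← sq_abs, sq]; gcongr
    have h7 : |a * α + b * β| ≤ (|a| + |b|) / 10000 := by
      have : |a * α + b * β| * (20000 * l) ≤ (|a| + |b|) / 10000 * (20000 * l) := by nlinarith
      exact le_of_mul_le_mul_right this (by positivity)
    have h8 : |a| * |α| ≤ |a| * (1 / 5000) := by gcongr
    have h9 : |b| * (4999 / 5000) ≤ |b| * β := by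
      gcongr; linarith [(abs_le.1 hβ).1]
    nlinarith [abs_nonneg a, abs_nonneg b]
  choose! f hf1 hf2 using hex
  have hmem : ∀ t s, |t| < l → |s| < l → (frm x τ n t s ∈ Ω ↔ f t < s) := by
    intro t s ht hs
    have huniq : ∀ s', |s'| ≤ l → frm x τ n t s' ∈ frontier Ω → s' = f t := by
      intro s' hs' hq
      have := hlip t (f t) t s' ht.le (hf1 t ht.le) ht.le hs' (hf2 t ht.le) hq
      simp only [sub_self, abs_zero] at this
      have := abs_nonpos_iff.1 this
      linarith
    have hs2 := abs_lt.1 hs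
    constructor
    · intro h
      by_contra hle
      push Not at hle
      have hne : s ≠ f t := by
        rintro rfl
        have := hf2 t ht.le
        rw [ho.frontier_eq] at this
        exact this.2 h
      refine hbot t ht.le (seg_mem ho (hcont t) (a := s) (b := -l) ?_ h)
      intro s' hs' hq
      rw [uIcc_of_ge (by linarith)] at hs'
      have := huniq s' (abs_le.2 ⟨hs'.1, by linarith [hs'.2]⟩) hq
      have := lt_of_le_of_ne hle hne
      linarith [hs'.2]
    · intro h
      refine seg_mem ho (hcont t) (a := l) (b := s) ?_ (htop t ht.le)
      intro s' hs' hq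
      rw [uIcc_of_ge (by linarith)] at hs'
      have := huniq s' (abs_le.2 ⟨by linarith [hs'.1], hs'.2⟩) hq
      linarith [hs'.1]
  have hder : ∀ t, |t| < l → ∃ d, HasDerivAt f d t ∧ |d| ≤ 1 / 1000 := by
    intro t ht
    obtain ⟨α, β, hα, hβ, h⟩ := hcmp t (f t) ht.le (hf1 t ht.le) (hf2 t ht.le)
    have hβ0 : 1 / 2 ≤ β := by linarith [(abs_le.1 hβ).1]
    have hβp : 0 < β := by linarith
    refine ⟨-α / β, ?_, ?_⟩
    · rw [hasDerivAt_iff_isLittleO]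
      have hO : (fun t' => f t' - f t - (t' - t) • (-α / β)) =O[𝓝 t] fun t' => (t' - t) ^ 2 := by
        refine Asymptotics.IsBigO.of_bound (1 / l) ?_
        have : {t' : ℝ | |t'| < l} ∈ 𝓝 t := (isOpen_lt continuous_abs continuous_const).mem_nhds ht
        filter_upwards [this] with t' ht'
        have ht' : |t'| < l := ht'
        have h := h t' (f t') (hf2 t' ht'.le)
        have hL := hlip t (f t) t' (f t') ht.le (hf1 t ht.le) ht'.le (hf1 t' ht'.le)
          (hf2 t ht.le) (hf2 t' ht'.le)
        have hsq : (f t' - f t) ^ 2 ≤ (t' - t) ^ 2 := sq_le_sq.2 hL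
        have e1 : f t' - f t - (t' - t) • (-α / β) = ((t' - t) * α + (f t' - f t) * β) / β := by
          rw [smul_eq_mul]; field_simp; ring
        rw [e1, Real.norm_eq_abs, Real.norm_eq_abs, abs_div, abs_of_pos hβp, abs_of_nonneg
          (sq_nonneg (t' - t)), div_le_iff₀ hβp]
        have : |(t' - t) * α + (f t' - f t) * β| ≤ (t' - t) ^ 2 / (10000 * l) := by
          rw [le_div_iff₀ (by positivity)]; linarith
        refine this.trans ?_
        rw [div_le_iff₀ (by positivity)]
        have : 1 / l * (t' - t) ^ 2 * β * (10000 * l) = 10000 * β * (t' - t) ^ 2 := by field_simp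
        rw [this]
        nlinarith [sq_nonneg (t' - t)]
      refine hO.trans_isLittleO ?_
      have h0 : (fun t' : ℝ => t' - t) =o[𝓝 t] fun _ => (1 : ℝ) := by
        rw [Asymptotics.isLittleO_one_iff]
        exact tendsto_sub_nhds_zero_iff.2 tendsto_id
      have := h0.mul_isBigO (Asymptotics.isBigO_refl (fun t' : ℝ => t' - t) (𝓝 t))
      simpa [sq] using this
    · rw [abs_div, abs_neg, abs_of_pos hβp, div_le_iff₀ hβp]
      linarith
  choose! f' hf' using hder
  let F : ℝ → ℝ := (Ioo (-l) l).piecewise f 0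
  have hFe : ∀ t, |t| < l → F t = f t := fun t ht => piecewise_eq_of_mem _ _ _ (abs_lt.1 ht)
  refine ⟨τ, n, F, f', hτ, hn, hτn, ?_, ?_, fun t ht => ?_, ?_⟩
  · refine ContinuousOn.measurable_piecewise ?_ continuousOn_const measurableSet_Ioo
    intro t ht
    exact (hf' t (abs_lt.2 ht)).1.continuousAt.continuousWithinAt
  · intro t ht
    refine ⟨(hf' t ht).1.congr_of_eventuallyEq ?_, (hf' t ht).2⟩
    have : {t' : ℝ | |t'| < l} ∈ 𝓝 t := (isOpen_lt continuous_abs continuous_const).mem_nhds ht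
    filter_upwards [this] with t' ht'
    exact hFe t' ht'
  · rw [hFe t ht]; exact hf1 t ht.le
  · intro t s ht hs
    rw [hFe t ht]; exact hmem t s ht hs

lemma frame_decomp {τ n : E2} (hτ : ‖τ‖ = 1) (hn : ‖n‖ = 1) (h : ⟪τ, n⟫ = 0) :
    ∃ σ : ℝ, σ ^ 2 = 1 ∧ τ 0 ^ 2 + τ 1 ^ 2 = 1 ∧ n 0 = -σ * τ 1 ∧ n 1 = σ * τ 0 := by
  have h1 : τ 0 ^ 2 + τ 1 ^ 2 = 1 := by
    have := EuclideanSpace.real_norm_sq_eq τ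
    rw [hτ, Fin.sum_univ_two] at this; linarith
  have h2 : n 0 ^ 2 + n 1 ^ 2 = 1 := by
    have := EuclideanSpace.real_norm_sq_eq n
    rw [hn, Fin.sum_univ_two] at this; linarith
  have h3 : τ 0 * n 0 + τ 1 * n 1 = 0 := by
    simp [PiLp.inner_apply, Fin.sum_univ_two] at h; linarith
  refine ⟨τ 0 * n 1 - τ 1 * n 0, ?_, h1, ?_, ?_⟩
  · linear_combination (n 0 ^ 2 + n 1 ^ 2) * h1 + h2 - (τ 0 * n 0 + τ 1 * n 1) * h3
  · linear_combination (-n 0) * h1 + τ 0 * h3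
  · linear_combination (-n 1) * h1 + τ 1 * h3

lemma vec_eq (w : E2) : w = w 0 • e 0 + w 1 • e 1 := by
  ext i; fin_cases i <;> simp [e]

lemma inner_e (w : E2) (i : Fin 2) : ⟪w, e i⟫ = w i := by
  simp [e, EuclideanSpace.inner_single_right]

lemma inner_app (L : E2 →L[ℝ] E2) (a b : E2) :
    ⟪L a, b⟫ = a 0 * b 0 * (L (e 0) 0) + a 1 * b 0 * (L (e 1) 0) + a 0 * b 1 * (L (e 0) 1)
      + a 1 * b 1 * (L (e 1) 1) := by
  conv_lhs => rw [vec_eq a]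
  simp [PiLp.inner_apply, Fin.sum_univ_two]; ring

lemma gradNormSq_expand (Y : E2 → E2) (y : E2) : gradNormSq Y y =
    (fderiv ℝ Y y (e 0) 0) ^ 2 + (fderiv ℝ Y y (e 1) 0) ^ 2 + (fderiv ℝ Y y (e 0) 1) ^ 2
      + (fderiv ℝ Y y (e 1) 1) ^ 2 := by
  simp only [gradNormSq, gradEntry, Fin.sum_univ_two, inner_e]; ring

lemma symGradNormSq_expand (Y : E2 → E2) (y : E2) : symGradNormSq Y y =
    (fderiv ℝ Y y (e 0) 0) ^ 2 + (fderiv ℝ Y y (e 1) 1) ^ 2 +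
      (fderiv ℝ Y y (e 1) 0 + fderiv ℝ Y y (e 0) 1) ^ 2 / 2 := by
  simp only [symGradNormSq, symGradEntry, gradEntry, Fin.sum_univ_two, inner_e]; ring

lemma gradNormSq_frame {τ n : E2} (hτ : ‖τ‖ = 1) (hn : ‖n‖ = 1) (h : ⟪τ, n⟫ = 0)
    (Y : E2 → E2) (y : E2) : gradNormSq Y y =
    ⟪fderiv ℝ Y y τ, τ⟫ ^ 2 + ⟪fderiv ℝ Y y n, τ⟫ ^ 2 + ⟪fderiv ℝ Y y τ, n⟫ ^ 2
      + ⟪fderiv ℝ Y y n, n⟫ ^ 2 := by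
  obtain ⟨σ, hσ, h1, h2, h3⟩ := frame_decomp hτ hn h
  rw [gradNormSq_expand]
  simp only [inner_app _ τ τ, inner_app _ τ n, inner_app _ n τ, inner_app _ n n, h2, h3]
  generalize τ 0 = a at *
  generalize τ 1 = b at *
  generalize fderiv ℝ Y y (e 0) 0 = g1
  generalize fderiv ℝ Y y (e 0) 1 = g2
  generalize fderiv ℝ Y y (e 1) 0 = g3
  generalize fderiv ℝ Y y (e 1) 1 = g4
  have h4 : (a ^ 2 + b ^ 2) ^ 2 = 1 := by rw [h1]; norm_num
  have hσ4 : σ ^ 4 = 1 := by nlinarith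
  ring_nf
  simp only [hσ, hσ4]
  linear_combination (-(g1 ^ 2 + g2 ^ 2 + g3 ^ 2 + g4 ^ 2)) * h4

lemma symGradNormSq_frame {τ n : E2} (hτ : ‖τ‖ = 1) (hn : ‖n‖ = 1) (h : ⟪τ, n⟫ = 0)
    (Y : E2 → E2) (y : E2) : symGradNormSq Y y =
    ⟪fderiv ℝ Y y τ, τ⟫ ^ 2 + ⟪fderiv ℝ Y y n, n⟫ ^ 2 + (⟪fderiv ℝ Y y n, τ⟫ +
      ⟪fderiv ℝ Y y τ, n⟫) ^ 2 / 2 := by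
  obtain ⟨σ, hσ, h1, h2, h3⟩ := frame_decomp hτ hn h
  rw [symGradNormSq_expand]
  simp only [inner_app _ τ τ, inner_app _ τ n, inner_app _ n τ, inner_app _ n n, h2, h3]
  generalize τ 0 = a at *
  generalize τ 1 = b at *
  generalize fderiv ℝ Y y (e 0) 0 = g1
  generalize fderiv ℝ Y y (e 0) 1 = g2
  generalize fderiv ℝ Y y (e 1) 0 = g3
  generalize fderiv ℝ Y y (e 1) 1 = g4
  have h4 : (a ^ 2 + b ^ 2) ^ 2 = 1 := by rw [h1]; norm_num
  have hσ4 : σ ^ 4 = 1 := by nlinarith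
  ring_nf
  simp only [hσ, hσ4]
  linear_combination (-(g1 ^ 2 + (g2 + g3) ^ 2 / 2 + g4 ^ 2)) * h4

lemma gradNormSq_nonneg (Y : E2 → E2) (y : E2) : 0 ≤ gradNormSq Y y := by
  unfold gradNormSq; positivity
lemma symGradNormSq_nonneg (Y : E2 → E2) (y : E2) : 0 ≤ symGradNormSq Y y := by
  unfold symGradNormSq; positivity

lemma measurable_gradEntry (Y : E2 → E2) (i j : Fin 2) :
    Measurable (fun y => gradEntry Y y i j) := by
  unfold gradEntry
  exact (measurable_fderiv_apply_const ℝ Y (e j)).inner_const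

lemma measurable_gradNormSq (Y : E2 → E2) : Measurable (gradNormSq Y) := by
  unfold gradNormSq
  exact Finset.measurable_sum _ fun i _ => Finset.measurable_sum _ fun j _ =>
    (measurable_gradEntry Y i j).pow_const 2

lemma measurable_symGradNormSq (Y : E2 → E2) : Measurable (symGradNormSq Y) := by
  unfold symGradNormSq symGradEntry
  exact Finset.measurable_sum _ fun i _ => Finset.measurable_sum _ fun j _ =>
    (((measurable_gradEntry Y i j).add (measurable_gradEntry Y j i)).div_const 2).pow_const 2

lemma symGradNormSq_le (Y : E2 → E2) (y : E2) : symGradNormSq Y y ≤ gradNormSq Y y := by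
  rw [symGradNormSq_expand, gradNormSq_expand]
  nlinarith [sq_nonneg (fderiv ℝ Y y (e 1) 0 - fderiv ℝ Y y (e 0) 1)]

lemma gradNormSq_congr {Y Z : E2 → E2} {y : E2} (h : Y =ᶠ[𝓝 y] Z) :
    gradNormSq Y y = gradNormSq Z y := by
  simp only [gradNormSq_expand, h.fderiv_eq]

lemma symGradNormSq_congr {Y Z : E2 → E2} {y : E2} (h : Y =ᶠ[𝓝 y] Z) :
    symGradNormSq Y y = symGradNormSq Z y := by
  simp only [symGradNormSq_expand, h.fderiv_eq]

lemma gradNormSq_zero (y : E2) : gradNormSq (fun _ => 0) y = 0 := by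
  simp [gradNormSq_expand]

lemma symGradNormSq_zero (y : E2) : symGradNormSq (fun _ => 0) y = 0 := by
  simp [symGradNormSq_expand]

lemma frm_measurePreserving (x : E2) {τ n : E2} (hτ : ‖τ‖ = 1) (hn : ‖n‖ = 1) (h : ⟪τ, n⟫ = 0)
    {f : ℝ → ℝ} (hf : Measurable f) :
    MeasurePreserving (fun p : ℝ × ℝ => frm x τ n p.1 (p.2 + f p.1)) volume volume := by
  have hon : Orthonormal ℝ ![τ, n] := by
    rw [orthonormal_iff_ite]
    intro i j
    fin_cases i <;> fin_cases j <;> simp [hτ, hn, h, real_inner_comm]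
  obtain ⟨b, hb⟩ := Orthonormal.exists_orthonormalBasis_extension_of_card_eq
    (𝕜 := ℝ) (E := E2) (ι := Fin 2) (v := ![τ, n]) (s := univ) (by simp) 
    (hon.comp _ Subtype.val_injective)
  have m1 : MeasurePreserving (fun p : ℝ × ℝ => (p.1, p.2 + f p.1)) volume volume := by
    rw [Measure.volume_eq_prod]
    refine (MeasurePreserving.id volume).skew_product (g := fun a c => c + f a) ?_ ?_
    · exact measurable_snd.add (hf.comp measurable_fst)
    · exact ae_of_all _ fun a => (measurePreserving_add_right volume (f a)).map_eq
  have m2 := (volume_preserving_finTwoArrow ℝ).symm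
  have m3 := PiLp.volume_preserving_toLp (Fin 2)
  have m4 := b.repr.symm.measurePreserving
  have m5 := measurePreserving_add_left (volume : Measure E2) x
  have := m5.comp (m4.comp (m3.comp (m2.comp m1)))
  convert! this using 1
  ext1 p
  simp only [Function.comp, frm]
  congr 1
  rw [← OrthonormalBasis.sum_repr_symm, Fin.sum_univ_two, hb 0 (mem_univ _), hb 1 (mem_univ _)]
  simp

lemma measurable_Qind {Q : Set E2} (hQ : IsOpen Q) {g : E2 → ℝ} (hg : Measurable g) :
    Measurable (Q.indicator fun y => ENNReal.ofReal (g y)) :=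
  hg.ennreal_ofReal.indicator hQ.measurableSet

lemma local_B {Ω : Set E2} (ho : IsOpen Ω) {l : ℝ} (hU : IsUBCWith Ω (10000 * l)) {x : E2}
    (hx : x ∈ frontier Ω) {Y : E2 → E2} (hY : DifferentiableOn ℝ Y Ω)
    (hz : ∀ y ∈ Ω, l / 4 < dist y x → Y y = 0)
    (hfin : ∫⁻ y in Ω, ENNReal.ofReal (gradNormSq Y y) < ∞) :
    ∫⁻ y in Ω, ENNReal.ofReal (gradNormSq Y y) ≤
      ENNReal.ofReal 400000 * ∫⁻ y in Ω, ENNReal.ofReal (symGradNormSq Y y) := by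
  obtain ⟨τ, n, f, f', hτ, hn, hτn, hfm, hfd, hfl, hgr⟩ := local_graph ho hU hx
  have hl : 0 < l := by have := hU.1; linarith
  set Q : Set E2 := Ω ∩ {y | |⟪y - x, τ⟫| < l ∧ |⟪y - x, n⟫| < l} with hQ
  have hQo : IsOpen Q := by
    refine ho.inter ?_
    have c1 : Continuous fun y : E2 => |⟪y - x, τ⟫| := by fun_prop
    have c2 : Continuous fun y : E2 => |⟪y - x, n⟫| := by fun_prop
    exact (isOpen_lt c1 continuous_const).inter (isOpen_lt c2 continuous_const)
  have hnτ : ⟪n, τ⟫ = 0 := by rw [real_inner_comm]; exact hτn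
  have hc1 : ∀ t s, ⟪frm x τ n t s - x, τ⟫ = t := by
    intro t s
    rw [show frm x τ n t s - x = t • τ + s • n by unfold frm; abel, inner_add_left,
      inner_smul_left, inner_smul_left, hnτ, real_inner_self_eq_norm_sq, hτ]; simp
  have hc2 : ∀ t s, ⟪frm x τ n t s - x, n⟫ = s := by
    intro t s
    rw [show frm x τ n t s - x = t • τ + s • n by unfold frm; abel, inner_add_left,
      inner_smul_left, inner_smul_left, hτn, real_inner_self_eq_norm_sq, hn]; simp
  set Ψ : ℝ × ℝ → E2 := fun p => frm x τ n p.1 (p.2 + f p.1) with hΨ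
  have hΨQ : ∀ p, Ψ p ∈ Q ↔ 0 < p.2 ∧ |p.1| < l ∧ |p.2 + f p.1| < l := by
    intro p
    have : Ψ p ∈ Q ↔ Ψ p ∈ Ω ∧ |p.1| < l ∧ |p.2 + f p.1| < l := by
      rw [hQ]
      show Ψ p ∈ Ω ∧ _ ↔ _
      rw [← hc1 p.1 (p.2 + f p.1), ← hc2 p.1 (p.2 + f p.1)]
      simp only [hc1, hc2]
      show Ψ p ∈ Ω ∧ (|⟪Ψ p - x, τ⟫| < l ∧ |⟪Ψ p - x, n⟫| < l) ↔ _
      simp only [hΨ, hc1, hc2]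
    rw [this]
    constructor
    · rintro ⟨h1, h2, h3⟩
      exact ⟨by linarith [(hgr _ _ h2 h3).1 h1], h2, h3⟩
    · rintro ⟨h1, h2, h3⟩
      exact ⟨(hgr _ _ h2 h3).2 (by linarith), h2, h3⟩
  set Z : E2 → E2 := Q.indicator Y with hZ
  have hfar : ∀ y ∈ Q, (l / 4 < |⟪y - x, τ⟫| ∨ l / 4 < |⟪y - x, n⟫|) → Y y = 0 := by
    intro y hy h
    refine hz y hy.1 ?_
    rw [dist_eq_norm]
    rcases h with h | h
    · have := abs_real_inner_le_norm (y - x) τ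
      rw [hτ, mul_one] at this; linarith
    · have := abs_real_inner_le_norm (y - x) n
      rw [hn, mul_one] at this; linarith
  have hZfar : ∀ p : ℝ × ℝ, (l / 4 < |p.1| ∨ l / 4 < |p.2 + f p.1|) → Z (Ψ p) = 0 := by
    intro p hp
    by_cases h : Ψ p ∈ Q
    · rw [hZ, indicator_of_mem h]
      apply hfar _ h
      simpa only [hΨ, hc1, hc2] using hp
    · exact indicator_of_notMem h _
  -- derivatives
  have hdA : ∀ p : ℝ × ℝ, Ψ p ∈ Q → ∃ L : ℝ × ℝ →L[ℝ] E2, L (1, 0) = τ + f' p.1 • n ∧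
      L (0, 1) = n ∧ HasFDerivAt (fun q => Z (Ψ q)) ((fderiv ℝ Y (Ψ p)).comp L) p := by
    intro p hp
    obtain ⟨h1, h2, h3⟩ := (hΨQ p).1 hp
    have d1 : HasFDerivAt (fun q : ℝ × ℝ => q.1) (ContinuousLinearMap.fst ℝ ℝ ℝ) p := hasFDerivAt_fst
    have d2 : HasFDerivAt (fun q : ℝ × ℝ => q.2) (ContinuousLinearMap.snd ℝ ℝ ℝ) p := hasFDerivAt_snd
    have d3 : HasFDerivAt (fun q : ℝ × ℝ => f q.1) (f' p.1 • ContinuousLinearMap.fst ℝ ℝ ℝ) p :=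
      (hfd p.1 h2).1.comp_hasFDerivAt p d1
    have d4 : HasFDerivAt Ψ _ p := ((d1.smul_const τ).add ((d2.add d3).smul_const n)).const_add x
    refine ⟨((ContinuousLinearMap.fst ℝ ℝ ℝ).smulRight τ + (ContinuousLinearMap.snd ℝ ℝ ℝ +
      f' p.1 • ContinuousLinearMap.fst ℝ ℝ ℝ).smulRight n), ?_, ?_, ?_⟩
    rotate_left 2
    · refine HasFDerivAt.comp (g := Z) (f := Ψ) p ?_ d4
      have : HasFDerivAt Y (fderiv ℝ Y (Ψ p)) (Ψ p) :=
        (hY.differentiableAt (ho.mem_nhds hp.1)).hasFDerivAt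
      refine this.congr_of_eventuallyEq ?_
      filter_upwards [hQo.mem_nhds hp] with y hy
      exact indicator_of_mem hy _
    · simp
    · simp
  have hdB : ∀ p : ℝ × ℝ, 0 < p.2 → Ψ p ∉ Q → (fun q => Z (Ψ q)) =ᶠ[𝓝 p] fun _ => 0 := by
    intro p hp hpQ
    by_cases h1 : |p.1| < l
    · have h2 : l ≤ |p.2 + f p.1| := by
        by_contra h; push Not at h; exact hpQ ((hΨQ p).2 ⟨hp, h1, h⟩)
      have hc : ContinuousAt (fun q : ℝ × ℝ => |q.2 + f q.1|) p := by
        have := (hfd p.1 h1).1.continuousAt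
        have h3 : ContinuousAt (fun q : ℝ × ℝ => f q.1) p := this.comp continuousAt_fst
        exact (continuousAt_snd.add h3).abs
      filter_upwards [hc.eventually (lt_mem_nhds (show l / 4 < _ by linarith))] with q hq
      exact hZfar q (Or.inr hq)
    · have hc : ContinuousAt (fun q : ℝ × ℝ => |q.1|) p := continuousAt_fst.abs
      filter_upwards [hc.eventually (lt_mem_nhds (show l / 4 < |p.1| by linarith))] with q hq
      exact hZfar q (Or.inl hq)
  set u : ℝ × ℝ → ℝ := fun q => ⟪Z (Ψ q), τ⟫ with hu
  set v : ℝ × ℝ → ℝ := fun q => ⟪Z (Ψ q), n⟫ with hv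
  have hdiff : ∀ w : E2, DifferentiableOn ℝ (fun q => ⟪Z (Ψ q), w⟫) {p | 0 < p.2} := by
    intro w p hp
    apply DifferentiableAt.differentiableWithinAt
    have : DifferentiableAt ℝ (fun q => Z (Ψ q)) p := by
      by_cases h : Ψ p ∈ Q
      · obtain ⟨L, _, _, hL⟩ := hdA p h
        exact hL.differentiableAt
      · exact (differentiableAt_const (0 : E2)).congr_of_eventuallyEq (hdB p hp h)
    exact this.inner ℝ (differentiableAt_const w)
  have hfdB : ∀ w : E2, ∀ p : ℝ × ℝ, 0 < p.2 → Ψ p ∉ Q → fderiv ℝ (fun q => ⟪Z (Ψ q), w⟫) p = 0 := by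
    intro w p hp hpQ
    have : (fun q => ⟪Z (Ψ q), w⟫) =ᶠ[𝓝 p] fun _ => 0 := by
      filter_upwards [hdB p hp hpQ] with q hq
      rw [hq, inner_zero_left]
    rw [this.fderiv_eq]; simp
  have hfdA : ∀ p : ℝ × ℝ, Ψ p ∈ Q → ∀ w : E2,
      fderiv ℝ (fun q => ⟪Z (Ψ q), w⟫) p (1, 0) = ⟪fderiv ℝ Y (Ψ p) τ, w⟫ +
        f' p.1 * ⟪fderiv ℝ Y (Ψ p) n, w⟫ ∧
      fderiv ℝ (fun q => ⟪Z (Ψ q), w⟫) p (0, 1) = ⟪fderiv ℝ Y (Ψ p) n, w⟫ := by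
    intro p hp w
    obtain ⟨L, h1, h2, hL⟩ := hdA p hp
    have := (hL.inner ℝ (hasFDerivAt_const w p)).fderiv
    rw [this]
    constructor
    · simp [h1, inner_add_left, inner_smul_left]
    · simp [h2]
  -- pointwise comparison
  set g1 : E2 → ℝ≥0∞ := Q.indicator fun y => ENNReal.ofReal (gradNormSq Y y) with hg1
  set g2 : E2 → ℝ≥0∞ := Q.indicator fun y => ENNReal.ofReal (symGradNormSq Y y) with hg2
  have mg1 : Measurable g1 := measurable_Qind hQo (measurable_gradNormSq Y)
  have mg2 : Measurable g2 := measurable_Qind hQo (measurable_symGradNormSq Y)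
  have hΨm := frm_measurePreserving x hτ hn hτn hfm
  have hHm : MeasurableSet {p : ℝ × ℝ | 0 < p.2} := measurableSet_lt measurable_const measurable_snd
  have hpush : ∀ g : E2 → ℝ≥0∞, Measurable g → (∀ y ∉ Q, g y = 0) →
      ∫⁻ y, g y = ∫⁻ p in {p : ℝ × ℝ | 0 < p.2}, g (Ψ p) := by
    intro g hg h0
    rw [← hΨm.lintegral_comp hg, ← lintegral_indicator hHm]
    refine lintegral_congr fun p => ?_
    by_cases hp : 0 < p.2
    · exact (indicator_of_mem (show p ∈ {p : ℝ × ℝ | 0 < p.2} from hp) (fun p => g (Ψ p))).symm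
    · rw [indicator_of_notMem (show p ∉ {p : ℝ × ℝ | 0 < p.2} from hp)]
      exact h0 _ fun h => hp ((hΨQ p).1 h).1
  have e1 := hpush g1 mg1 fun y hy => indicator_of_notMem hy _
  have e2 := hpush g2 mg2 fun y hy => indicator_of_notMem hy _
  have hsmall : ∀ p, Ψ p ∈ Q → f' p.1 ^ 2 ≤ 1 / 1000000 := by
    intro p hp
    have := (hfd p.1 ((hΨQ p).1 hp).2.1).2
    rw [← sq_abs]
    calc |f' p.1| ^ 2 ≤ (1 / 1000) ^ 2 := by gcongr
      _ = _ := by norm_num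
  have hmul : ∀ c a b : ℝ, c ^ 2 ≤ 1 / 1000000 → c ^ 2 * b ^ 2 ≤ 1 / 1000000 * b ^ 2 := by
    intro c a b h; gcongr
  have P1 : ∀ p : ℝ × ℝ, 0 < p.2 → g1 (Ψ p) ≤ ENNReal.ofReal 2 * ENNReal.ofReal (gD u v p) := by
    intro p hp
    by_cases h : Ψ p ∈ Q
    · rw [hg1, indicator_of_mem h, ← ENNReal.ofReal_mul (by norm_num)]
      apply ENNReal.ofReal_le_ofReal
      rw [gradNormSq_frame hτ hn hτn]
      simp only [gD]
      obtain ⟨a1, a2⟩ := hfdA p h τ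
      obtain ⟨a3, a4⟩ := hfdA p h n
      rw [a1, a2, a3, a4]
      have hs := hsmall p h
      generalize f' p.1 = c at *
      generalize ⟪fderiv ℝ Y (Ψ p) τ, τ⟫ = A
      generalize ⟪fderiv ℝ Y (Ψ p) n, τ⟫ = B
      generalize ⟪fderiv ℝ Y (Ψ p) τ, n⟫ = C
      generalize ⟪fderiv ℝ Y (Ψ p) n, n⟫ = D
      nlinarith [hmul c A B hs, hmul c C D hs, sq_nonneg (A + 2 * (c * B)), sq_nonneg (C + 2 * (c * D)),
        sq_nonneg B, sq_nonneg D]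
    · rw [hg1, indicator_of_notMem h]; exact zero_le
  have P2 : ∀ p : ℝ × ℝ, 0 < p.2 → ENNReal.ofReal (gD u v p) ≤ ENNReal.ofReal 4 * g1 (Ψ p) := by
    intro p hp
    by_cases h : Ψ p ∈ Q
    · rw [hg1, indicator_of_mem h, ← ENNReal.ofReal_mul (by norm_num)]
      apply ENNReal.ofReal_le_ofReal
      rw [gradNormSq_frame hτ hn hτn]
      simp only [gD]
      obtain ⟨a1, a2⟩ := hfdA p h τ
      obtain ⟨a3, a4⟩ := hfdA p h n
      rw [a1, a2, a3, a4]
      have hs := hsmall p h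
      generalize f' p.1 = c at *
      generalize ⟪fderiv ℝ Y (Ψ p) τ, τ⟫ = A
      generalize ⟪fderiv ℝ Y (Ψ p) n, τ⟫ = B
      generalize ⟪fderiv ℝ Y (Ψ p) τ, n⟫ = C
      generalize ⟪fderiv ℝ Y (Ψ p) n, n⟫ = D
      nlinarith [hmul c A B hs, hmul c C D hs, sq_nonneg (A - c * B), sq_nonneg (C - c * D),
        sq_nonneg B, sq_nonneg D, sq_nonneg A, sq_nonneg C]
    · have : gD u v p = 0 := by
        simp only [gD, hu, hv, hfdB _ p hp h]; simp
      rw [this]; simp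
  have P3 : ∀ p : ℝ × ℝ, 0 < p.2 → ENNReal.ofReal (sD u v p) ≤ ENNReal.ofReal 4 * g2 (Ψ p) +
      ENNReal.ofReal (6 / 1000000) * g1 (Ψ p) := by
    intro p hp
    by_cases h : Ψ p ∈ Q
    · rw [hg1, hg2, indicator_of_mem h, indicator_of_mem h, ← ENNReal.ofReal_mul (by norm_num),
        ← ENNReal.ofReal_mul (by norm_num), ← ENNReal.ofReal_add
          (mul_nonneg (by norm_num) (symGradNormSq_nonneg _ _))
          (mul_nonneg (by norm_num) (gradNormSq_nonneg _ _))]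
      apply ENNReal.ofReal_le_ofReal
      rw [gradNormSq_frame hτ hn hτn, symGradNormSq_frame hτ hn hτn]
      simp only [sD]
      obtain ⟨a1, a2⟩ := hfdA p h τ
      obtain ⟨a3, a4⟩ := hfdA p h n
      rw [a1, a2, a3, a4]
      have hs := hsmall p h
      generalize f' p.1 = c at *
      generalize ⟪fderiv ℝ Y (Ψ p) τ, τ⟫ = A
      generalize ⟪fderiv ℝ Y (Ψ p) n, τ⟫ = B
      generalize ⟪fderiv ℝ Y (Ψ p) τ, n⟫ = C
      generalize ⟪fderiv ℝ Y (Ψ p) n, n⟫ = D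
      nlinarith [hmul c A B hs, hmul c C D hs, sq_nonneg (A - c * B),
        sq_nonneg (B + C - c * D),
        sq_nonneg B, sq_nonneg D, sq_nonneg A, sq_nonneg C]
    · have : sD u v p = 0 := by
        simp only [sD, hu, hv, hfdB _ p hp h]; simp
      rw [this]; simp
  -- integrals
  have hI1 : ∫⁻ y in Ω, ENNReal.ofReal (gradNormSq Y y) = ∫⁻ y, g1 y := by
    rw [← lintegral_indicator ho.measurableSet]
    refine lintegral_congr fun y => ?_
    by_cases hy : y ∈ Ω
    · rw [indicator_of_mem hy]
      by_cases hyQ : y ∈ Q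
      · rw [hg1, indicator_of_mem hyQ]
      · rw [hg1, indicator_of_notMem hyQ]
        have hd : l / 4 < dist y x := by
          by_contra hle
          push Not at hle
          rw [dist_eq_norm] at hle
          refine hyQ ⟨hy, ?_, ?_⟩
          · have := abs_real_inner_le_norm (y - x) τ
            rw [hτ, mul_one] at this; linarith
          · have := abs_real_inner_le_norm (y - x) n
            rw [hn, mul_one] at this; linarith
        have : Y =ᶠ[𝓝 y] fun _ => 0 := by
          have hopen : IsOpen {w : E2 | l / 4 < dist w x} :=
            isOpen_lt continuous_const (continuous_id.dist continuous_const)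
          filter_upwards [ho.mem_nhds hy, hopen.mem_nhds hd] with w hw1 hw2
          exact hz w hw1 hw2
        rw [gradNormSq_congr this, gradNormSq_zero]; simp
    · rw [indicator_of_notMem hy, hg1, indicator_of_notMem fun h => hy h.1]
  have hI2 : ∫⁻ y, g2 y ≤ ∫⁻ y in Ω, ENNReal.ofReal (symGradNormSq Y y) := by
    rw [hg2, lintegral_indicator hQo.measurableSet]
    exact lintegral_mono_set inter_subset_left
  rw [hI1] at hfin ⊢
  have hg : ∫⁻ p in {p : ℝ × ℝ | 0 < p.2}, ENNReal.ofReal (gD u v p) < ∞ := by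
    refine (setLIntegral_mono' hHm P2).trans_lt ?_
    have m1 : Measurable fun p => g1 (Ψ p) := mg1.comp hΨm.measurable
    rw [lintegral_const_mul _ m1, ← e1]
    exact ENNReal.mul_lt_top ENNReal.ofReal_lt_top hfin
  have hk := half_korn (hdiff τ) (hdiff n) (R := 2 * l) (by
    intro p hp hR
    have : Z (Ψ p) = 0 := by
      apply hZfar
      by_contra hne
      push Not at hne
      rw [Prod.norm_def, le_sup_iff, Real.norm_eq_abs, Real.norm_eq_abs] at hR
      have h1 := abs_le.1 (hfl p.1 (by linarith))
      have h2 := abs_le.1 hne.2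
      rw [abs_of_pos hp] at hR
      rcases hR with h | h <;> linarith
    rw [this, inner_zero_left]) hg
  have f1 : ∫⁻ y, g1 y ≤ ENNReal.ofReal 2 * ∫⁻ p in {p : ℝ × ℝ | 0 < p.2}, ENNReal.ofReal (gD u v p) := by
    rw [e1, ← lintegral_const_mul _ (measurable_gD u v).ennreal_ofReal]
    exact setLIntegral_mono' hHm P1
  have f3 : ∫⁻ p in {p : ℝ × ℝ | 0 < p.2}, ENNReal.ofReal (sD u v p) ≤
      ENNReal.ofReal 4 * (∫⁻ y, g2 y) + ENNReal.ofReal (6 / 1000000) * ∫⁻ y, g1 y := by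
    have m1 : Measurable fun p => g1 (Ψ p) := mg1.comp hΨm.measurable
    have m2 : Measurable fun p => g2 (Ψ p) := mg2.comp hΨm.measurable
    rw [e1, e2, ← lintegral_const_mul _ m1, ← lintegral_const_mul _ m2,
      ← lintegral_add_left (m2.const_mul _)]
    exact setLIntegral_mono' hHm P3
  have f4 : ∫⁻ y, g1 y ≤ ENNReal.ofReal 2 * (ENNReal.ofReal 25000 * (ENNReal.ofReal 4 * (∫⁻ y, g2 y)
      + ENNReal.ofReal (6 / 1000000) * ∫⁻ y, g1 y)) :=
    f1.trans (mul_le_mul_right (hk.trans (mul_le_mul_right f3 _)) _)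
  refine le_trans ?_ (mul_le_mul_right hI2 _)
  generalize ∫⁻ y, g1 y = I1 at *
  generalize ∫⁻ y, g2 y = I2 at *
  by_cases hI : I2 = ∞
  · rw [hI, ENNReal.mul_top (by simp)]; exact le_top
  · lift I1 to ℝ≥0 using hfin.ne
    lift I2 to ℝ≥0 using hI
    have c1 : ∀ a : ℝ≥0, (a : ℝ≥0∞) = ENNReal.ofReal a := fun a => (ENNReal.ofReal_coe_nnreal).symm
    rw [c1 I1, c1 I2] at f4 ⊢
    rw [← ENNReal.ofReal_mul (by norm_num), ← ENNReal.ofReal_mul (by norm_num),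
      ← ENNReal.ofReal_add (by positivity) (by positivity), ← ENNReal.ofReal_mul (by norm_num),
      ← ENNReal.ofReal_mul (by norm_num), ENNReal.ofReal_le_ofReal_iff (by positivity)] at f4
    rw [← ENNReal.ofReal_mul (by norm_num)]
    apply ENNReal.ofReal_le_ofReal
    have := I1.2
    have := I2.2
    nlinarith [I1.coe_nonneg, I2.coe_nonneg]

lemma memLp_of_sq_le' {f : E2 → ℝ} {G : E2 → ℝ} (hf : Measurable f)
    (hle : ∀ p, f p ^ 2 ≤ G p) (hG : ∫⁻ p, ENNReal.ofReal (G p) < ∞) : MemLp f 2 volume := by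
  rw [memLp_two_iff_integrable_sq hf.aestronglyMeasurable]
  refine ⟨(hf.pow_const 2).aestronglyMeasurable, ?_⟩
  rw [hasFiniteIntegral_iff_ofReal (ae_of_all _ fun p => sq_nonneg _)]
  exact (lintegral_mono fun p => ENNReal.ofReal_le_ofReal (hle p)).trans_lt hG

/-- Korn on the whole plane, for differentiable compactly supported fields. -/
lemma korn_E2 {W : E2 → E2} (hW : Differentiable ℝ W) (hc : HasCompactSupport W)
    (hfin : ∫⁻ y, ENNReal.ofReal (gradNormSq W y) < ∞) :
    ∫⁻ y, ENNReal.ofReal (gradNormSq W y) ≤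
      ENNReal.ofReal 2 * ∫⁻ y, ENNReal.ofReal (symGradNormSq W y) := by
  set u : E2 → ℝ := fun y => ⟪W y, e 0⟫ with hu
  set v : E2 → ℝ := fun y => ⟪W y, e 1⟫ with hv
  have dw : ∀ w : E2, Differentiable ℝ (fun y => ⟪W y, w⟫) := fun w y =>
    (hW y).inner ℝ (differentiableAt_const w)
  have fd : ∀ (y w a : E2), fderiv ℝ (fun y => ⟪W y, w⟫) y a = ⟪fderiv ℝ W y a, w⟫ := by
    intro y w a
    have := ((hW y).hasFDerivAt.inner ℝ (hasFDerivAt_const w y)).fderiv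
    rw [this]; simp
  have mm : ∀ i j : Fin 2, Measurable (fun y => fderiv ℝ (fun y => ⟪W y, e i⟫) y (e j)) := fun i j =>
    measurable_fderiv_apply_const ℝ _ (e j)
  have ge : ∀ y, gradNormSq W y = fderiv ℝ u y (e 0) ^ 2 + fderiv ℝ u y (e 1) ^ 2 +
      fderiv ℝ v y (e 0) ^ 2 + fderiv ℝ v y (e 1) ^ 2 := by
    intro y
    simp only [hu, hv, fd]; simp only [inner_e, gradNormSq_expand]
  have se : ∀ y, 2 * symGradNormSq W y = 2 * fderiv ℝ u y (e 0) ^ 2 + 2 * fderiv ℝ v y (e 1) ^ 2 +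
      (fderiv ℝ u y (e 1) + fderiv ℝ v y (e 0)) ^ 2 := by
    intro y
    simp only [hu, hv, fd]; simp only [inner_e, symGradNormSq_expand]; ring
  have l1 := memLp_of_sq_le' (mm 0 0) (G := gradNormSq W) (fun p => by
    rw [ge]; nlinarith [sq_nonneg (fderiv ℝ u p (e 1)), sq_nonneg (fderiv ℝ v p (e 0)), sq_nonneg (fderiv ℝ v p (e 1))]) hfin
  have l2 := memLp_of_sq_le' (mm 0 1) (G := gradNormSq W) (fun p => by
    rw [ge]; nlinarith [sq_nonneg (fderiv ℝ u p (e 0)), sq_nonneg (fderiv ℝ v p (e 0)), sq_nonneg (fderiv ℝ v p (e 1))]) hfin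
  have l3 := memLp_of_sq_le' (mm 1 0) (G := gradNormSq W) (fun p => by
    rw [ge]; nlinarith [sq_nonneg (fderiv ℝ u p (e 1)), sq_nonneg (fderiv ℝ u p (e 0)), sq_nonneg (fderiv ℝ v p (e 1))]) hfin
  have l4 := memLp_of_sq_le' (mm 1 1) (G := gradNormSq W) (fun p => by
    rw [ge]; nlinarith [sq_nonneg (fderiv ℝ u p (e 1)), sq_nonneg (fderiv ℝ v p (e 0)), sq_nonneg (fderiv ℝ u p (e 0))]) hfin
  have cU : HasCompactSupport u := by
    refine hc.mono' ?_
    intro y hy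
    apply subset_tsupport
    intro h0
    exact hy (by simp [hu, h0])
  have pk := plane_korn (μ := volume) (dw (e 0)) (dw (e 1)) cU l1 l2 l3 l4
  have iG : Integrable (fun y => gradNormSq W y) volume := by
    simp only [ge]
    exact ((l1.integrable_sq.add l2.integrable_sq).add l3.integrable_sq).add l4.integrable_sq
  have iS : Integrable (fun y => 2 * symGradNormSq W y) volume := by
    simp only [se]
    exact ((l1.integrable_sq.const_mul 2).add (l4.integrable_sq.const_mul 2)).add
      (l2.add l3).integrable_sq
  rw [← lintegral_const_mul _ (measurable_symGradNormSq W).ennreal_ofReal]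
  have : ∀ y, ENNReal.ofReal 2 * ENNReal.ofReal (symGradNormSq W y) =
      ENNReal.ofReal (2 * symGradNormSq W y) := fun y => (ENNReal.ofReal_mul (by norm_num)).symm
  simp only [this]
  rw [← ofReal_integral_eq_lintegral_ofReal iG (ae_of_all _ (gradNormSq_nonneg W)),
      ← ofReal_integral_eq_lintegral_ofReal iS (ae_of_all _ fun y =>
        mul_nonneg (by norm_num) (symGradNormSq_nonneg W y))]
  apply ENNReal.ofReal_le_ofReal
  simp only [ge, se]
  exact pk

lemma local_A {Ω : Set E2} (ho : IsOpen Ω) {ρ : ℝ} {z : E2}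
    (hz0 : ∀ x ∈ frontier Ω, ρ < dist x z) {Y : E2 → E2} (hY : DifferentiableOn ℝ Y Ω)
    (hz : ∀ y ∈ Ω, ρ < dist y z → Y y = 0)
    (hfin : ∫⁻ y in Ω, ENNReal.ofReal (gradNormSq Y y) < ∞) :
    ∫⁻ y in Ω, ENNReal.ofReal (gradNormSq Y y) ≤
      ENNReal.ofReal 2 * ∫⁻ y in Ω, ENNReal.ofReal (symGradNormSq Y y) := by
  set W : E2 → E2 := Ω.indicator Y with hWd
  have hin : ∀ y ∈ Ω, W =ᶠ[𝓝 y] Y := by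
    intro y hy
    filter_upwards [ho.mem_nhds hy] with w hw
    exact indicator_of_mem hw _
  have hout : ∀ y ∉ Ω, W =ᶠ[𝓝 y] fun _ => 0 := by
    intro y hy
    by_cases hc : y ∈ closure Ω
    · have hf : y ∈ frontier Ω := by rw [ho.frontier_eq]; exact ⟨hc, hy⟩
      have hopen : IsOpen {w : E2 | ρ < dist w z} :=
            isOpen_lt continuous_const (continuous_id.dist continuous_const)
      filter_upwards [hopen.mem_nhds (hz0 y hf)] with w hw
      by_cases hw' : w ∈ Ω
      · rw [hWd, indicator_of_mem hw']; exact hz w hw' hw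
      · exact indicator_of_notMem hw' _
    · filter_upwards [isClosed_closure.isOpen_compl.mem_nhds hc] with w hw
      exact indicator_of_notMem (fun h => hw (subset_closure h)) _
  have hW : Differentiable ℝ W := by
    intro y
    by_cases hy : y ∈ Ω
    · exact (hY.differentiableAt (ho.mem_nhds hy)).congr_of_eventuallyEq (hin y hy)
    · exact (differentiableAt_const (0 : E2)).congr_of_eventuallyEq (hout y hy)
  have hc : HasCompactSupport W := by
    refine HasCompactSupport.of_support_subset_isCompact (isCompact_closedBall z ρ) ?_
    intro y hy
    by_contra hn
    rw [mem_closedBall, not_le] at hn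
    apply hy
    by_cases hw' : y ∈ Ω
    · rw [hWd, indicator_of_mem hw']; exact hz y hw' hn
    · exact indicator_of_notMem hw' _
  have e1 : ∫⁻ y in Ω, ENNReal.ofReal (gradNormSq Y y) = ∫⁻ y, ENNReal.ofReal (gradNormSq W y) := by
    rw [← lintegral_indicator ho.measurableSet]
    refine lintegral_congr fun y => ?_
    by_cases hy : y ∈ Ω
    · rw [indicator_of_mem hy, gradNormSq_congr (hin y hy)]
    · rw [indicator_of_notMem hy, gradNormSq_congr (hout y hy), gradNormSq_zero]; simp
  have e2 : ∫⁻ y in Ω, ENNReal.ofReal (symGradNormSq Y y) =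
      ∫⁻ y, ENNReal.ofReal (symGradNormSq W y) := by
    rw [← lintegral_indicator ho.measurableSet]
    refine lintegral_congr fun y => ?_
    by_cases hy : y ∈ Ω
    · rw [indicator_of_mem hy, symGradNormSq_congr (hin y hy)]
    · rw [indicator_of_notMem hy, symGradNormSq_congr (hout y hy), symGradNormSq_zero]; simp
  rw [e1] at hfin ⊢
  rw [e2]
  exact korn_E2 hW hc hfin

lemma local_ML {Ω : Set E2} (ho : IsOpen Ω) {l : ℝ} (hU : IsUBCWith Ω (10000 * l)) (z : E2)
    {Y : E2 → E2} (hY : DifferentiableOn ℝ Y Ω)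
    (hz : ∀ y ∈ Ω, l / 8 < dist y z → Y y = 0)
    (hfin : ∫⁻ y in Ω, ENNReal.ofReal (gradNormSq Y y) < ∞) :
    ∫⁻ y in Ω, ENNReal.ofReal (gradNormSq Y y) ≤
      ENNReal.ofReal 400000 * ∫⁻ y in Ω, ENNReal.ofReal (symGradNormSq Y y) := by
  by_cases h : ∃ x ∈ frontier Ω, dist x z ≤ l / 8
  · obtain ⟨x, hx, hxz⟩ := h
    refine local_B ho hU hx hY (fun y hy hd => hz y hy ?_) hfin
    have := dist_triangle y z x
    rw [dist_comm z x] at this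
    linarith
  · push Not at h
    refine (local_A ho h hY hz hfin).trans ?_
    gcongr
    norm_num

/-- squared gradient of a scalar -/
def gS (θ : E2 → ℝ) (y : E2) : ℝ := (fderiv ℝ θ y (e 0)) ^ 2 + (fderiv ℝ θ y (e 1)) ^ 2

lemma norm_sq_eq (w : E2) : ‖w‖ ^ 2 = w 0 ^ 2 + w 1 ^ 2 := by
  rw [EuclideanSpace.real_norm_sq_eq, Fin.sum_univ_two]

lemma norm_e (i : Fin 2) : ‖e i‖ = 1 := by simp [e]

lemma gS_nonneg (θ : E2 → ℝ) (y : E2) : 0 ≤ gS θ y := by unfold gS; positivity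

lemma gS_le {θ : E2 → ℝ} {y : E2} {K : ℝ} (h : ‖fderiv ℝ θ y‖ ≤ K) : gS θ y ≤ 2 * K ^ 2 := by
  have : ∀ i, (fderiv ℝ θ y (e i)) ^ 2 ≤ K ^ 2 := by
    intro i
    rw [← sq_abs]
    have h1 := (fderiv ℝ θ y).le_opNorm (e i)
    rw [norm_e, mul_one, Real.norm_eq_abs] at h1
    gcongr
    exact h1.trans h
  unfold gS
  linarith [this 0, this 1]

lemma fderiv_prod {θ : E2 → ℝ} {X : E2 → E2} {y : E2} (hθ : DifferentiableAt ℝ θ y)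
    (hX : DifferentiableAt ℝ X y) (a : E2) (i : Fin 2) :
    fderiv ℝ (fun w => θ w • X w) y a i = θ y * fderiv ℝ X y a i + fderiv ℝ θ y a * X y i := by
  have := (hθ.hasFDerivAt.smul hX.hasFDerivAt).fderiv
  rw [show (fun w => θ w • X w) = θ • X from rfl, this]
  simp

lemma prod_a {θ : E2 → ℝ} {X : E2 → E2} {y : E2} (hθ : DifferentiableAt ℝ θ y)
    (hX : DifferentiableAt ℝ X y) :
    gradNormSq (fun w => θ w • X w) y ≤ 2 * (θ y ^ 2 * gradNormSq X y) + 2 * (gS θ y * ‖X y‖ ^ 2) := by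
  rw [gradNormSq_expand, gradNormSq_expand, gS, norm_sq_eq]
  simp only [fderiv_prod hθ hX]
  have h : ∀ a b : ℝ, (a + b) ^ 2 ≤ 2 * a ^ 2 + 2 * b ^ 2 := fun a b => by
    nlinarith [sq_nonneg (a - b)]
  refine (add_le_add (add_le_add (add_le_add (h _ _) (h _ _)) (h _ _)) (h _ _)).trans (le_of_eq ?_)
  ring

lemma prod_b {θ : E2 → ℝ} {X : E2 → E2} {y : E2} (hθ : DifferentiableAt ℝ θ y)
    (hX : DifferentiableAt ℝ X y) :
    θ y ^ 2 * gradNormSq X y ≤ 2 * gradNormSq (fun w => θ w • X w) y + 2 * (gS θ y * ‖X y‖ ^ 2) := by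
  rw [gradNormSq_expand, gradNormSq_expand, gS, norm_sq_eq]
  simp only [fderiv_prod hθ hX]
  have h : ∀ a b : ℝ, a ^ 2 ≤ 2 * (a + b) ^ 2 + 2 * b ^ 2 := fun a b => by
    nlinarith [sq_nonneg (a + 2 * b)]
  have h1 := h (θ y * fderiv ℝ X y (e 0) 0) (fderiv ℝ θ y (e 0) * X y 0)
  have h2 := h (θ y * fderiv ℝ X y (e 1) 0) (fderiv ℝ θ y (e 1) * X y 0)
  have h3 := h (θ y * fderiv ℝ X y (e 0) 1) (fderiv ℝ θ y (e 0) * X y 1)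
  have h4 := h (θ y * fderiv ℝ X y (e 1) 1) (fderiv ℝ θ y (e 1) * X y 1)
  linarith [add_le_add (add_le_add (add_le_add h1 h2) h3) h4]

lemma prod_c {θ : E2 → ℝ} {X : E2 → E2} {y : E2} (hθ : DifferentiableAt ℝ θ y)
    (hX : DifferentiableAt ℝ X y) :
    symGradNormSq (fun w => θ w • X w) y ≤
      2 * (θ y ^ 2 * symGradNormSq X y) + 2 * (gS θ y * ‖X y‖ ^ 2) := by
  rw [symGradNormSq_expand, symGradNormSq_expand, gS, norm_sq_eq]
  simp only [fderiv_prod hθ hX]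
  have h : ∀ a b : ℝ, (a + b) ^ 2 ≤ 2 * a ^ 2 + 2 * b ^ 2 := fun a b => by
    nlinarith [sq_nonneg (a - b)]
  generalize fderiv ℝ X y (e 0) 0 = g1
  generalize fderiv ℝ X y (e 0) 1 = g2
  generalize fderiv ℝ X y (e 1) 0 = g3
  generalize fderiv ℝ X y (e 1) 1 = g4
  generalize fderiv ℝ θ y (e 0) = p
  generalize fderiv ℝ θ y (e 1) = q
  generalize X y 0 = a
  generalize X y 1 = b
  generalize θ y = t
  have h1 := h (t * g1) (p * a)
  have h2 := h (t * g4) (q * b)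
  have h3 := h (t * (g3 + g2)) (q * a + p * b)
  have h4 := h (q * a) (p * b)
  nlinarith [h1, h2, h3, h4, sq_nonneg (q * a), sq_nonneg (p * b)]

lemma tonelli_set {G : E2 → ℝ≥0∞} (hG : Measurable G) (B : E2 → Set E2)
    (hB : ∀ y z, y ∈ B z ↔ z ∈ B y) (hm : MeasurableSet {p : E2 × E2 | p.2 ∈ B p.1})
    {V : ℝ≥0∞} (hV : ∀ y, volume (B y) = V) (hBm : ∀ y, MeasurableSet (B y)) :
    ∫⁻ z, ∫⁻ y, (B z).indicator G y = V * ∫⁻ y, G y := by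
  have hmeas : Measurable (Function.uncurry fun z y => (B z).indicator G y) := by
    have : (Function.uncurry fun z y => (B z).indicator G y) =
        {p : E2 × E2 | p.2 ∈ B p.1}.indicator (fun p => G p.2) := by
      ext p
      rfl
    rw [this]
    exact (hG.comp measurable_snd).indicator hm
  rw [lintegral_lintegral_swap hmeas.aemeasurable, ← lintegral_const_mul _ hG]
  refine lintegral_congr fun y => ?_
  have : ∀ z, (B z).indicator G y = (B y).indicator (fun _ => G y) z := by
    intro z
    by_cases h : y ∈ B z
    · rw [indicator_of_mem h, indicator_of_mem ((hB y z).1 h)]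
    · rw [indicator_of_notMem h, indicator_of_notMem (fun h' => h ((hB y z).2 h'))]
  simp only [this]
  rw [lintegral_indicator_const (hBm y), hV, mul_comm]

lemma exists_bump : ∃ (χ : E2 → ℝ) (K : ℝ), 1 ≤ K ∧ Differentiable ℝ χ ∧ (∀ y, ‖fderiv ℝ χ y‖ ≤ K) ∧
    (∀ y, 0 ≤ χ y ∧ χ y ≤ 1) ∧ (∀ y, ‖y‖ < 1 → χ y = 1) ∧ (∀ y, 2 < ‖y‖ → χ y = 0) := by
  let χ : ContDiffBump (0 : E2) := ⟨1, 2, by norm_num, by norm_num⟩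
  have hs : ContDiff ℝ 1 χ := χ.contDiff
  have hc : HasCompactSupport (fderiv ℝ χ) := χ.hasCompactSupport.fderiv ℝ
  obtain ⟨K, hK⟩ := (hs.continuous_fderiv one_ne_zero).bounded_above_of_compact_support hc
  refine ⟨χ, max K 1, le_max_right _ _, hs.differentiable one_ne_zero, fun y => (hK y).trans (le_max_left _ _),
    fun y => ⟨χ.nonneg, χ.le_one⟩, fun y hy => χ.one_of_mem_closedBall ?_, fun y hy => χ.zero_of_le_dist ?_⟩
  · simp; exact hy.le
  · simp; exact hy.le

/-- independent constant for part (i) -/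
lemma cover : ∃ C : ℝ, 0 < C ∧ ∀ (Ω : Set E2) (l : ℝ), IsOpen Ω → IsUBCWith Ω (10000 * l) →
    ∀ X : E2 → E2, DifferentiableOn ℝ X Ω →
    ∫⁻ y in Ω, ENNReal.ofReal (gradNormSq X y) < ∞ → ∫⁻ y in Ω, ENNReal.ofReal (‖X y‖ ^ 2) < ∞ →
    ∫⁻ y in Ω, ENNReal.ofReal (gradNormSq X y) ≤ ENNReal.ofReal C *
      ∫⁻ y in Ω, ENNReal.ofReal (symGradNormSq X y + ‖X y‖ ^ 2 / l ^ 2) := by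
  obtain ⟨χ, K, hK1, hχd, hχK, hχr, hχ1, hχ2⟩ := exists_bump
  refine ⟨16000000 * (256 * K ^ 2), by positivity, ?_⟩
  intro Ω l ho hU X hX hg hN
  have hl : 0 < l := by have := hU.1; linarith
  set s : ℝ := l / 16 with hs
  have hspos : 0 < s := by positivity
  set M : ℝ := K ^ 2 / s ^ 2 with hM
  have hMpos : 0 < M := by positivity
  set G : E2 → ℝ≥0∞ := Ω.indicator fun y => ENNReal.ofReal (gradNormSq X y) with hG
  set H : E2 → ℝ≥0∞ := Ω.indicator fun y => ENNReal.ofReal (symGradNormSq X y + M * ‖X y‖ ^ 2) with hH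
  have mG : Measurable G := measurable_Qind ho (measurable_gradNormSq X)
  have mX : Measurable (Ω.indicator fun y => ‖X y‖ ^ 2) := by
    classical
    have := (ContinuousOn.measurable_piecewise (s := Ω) (f := fun y => ‖X y‖ ^ 2) (g := fun _ => (0 : ℝ))
      ((hX.continuousOn.norm).pow 2) continuousOn_const ho.measurableSet)
    exact (Set.piecewise_eq_indicator (s := Ω) (f := fun y => ‖X y‖ ^ 2)) ▸ this
  have mH : Measurable H := by
    have : H = Ω.indicator fun y => ENNReal.ofReal (symGradNormSq X y + M * (Ω.indicator (fun y => ‖X y‖ ^ 2) y)) := by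
      rw [hH]
      ext y
      by_cases hy : y ∈ Ω
      · simp only [indicator_of_mem hy]
      · simp only [indicator_of_notMem hy]
    rw [this]
    exact measurable_Qind ho ((measurable_symGradNormSq X).add (mX.const_mul M))
  have hloc : ∀ z, ∫⁻ y, (ball z s).indicator G y ≤
      ENNReal.ofReal 4000000 * ∫⁻ y, (closedBall z (2 * s)).indicator H y := by
    intro z
    set θ : E2 → ℝ := fun y => χ ((1 / s) • (y - z)) with hθ
    have hin : ∀ y : E2, HasFDerivAt (fun y : E2 => (1 / s) • (y - z))
        ((1 / s) • ContinuousLinearMap.id ℝ E2) y := fun y =>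
      ((hasFDerivAt_id y).sub_const z).const_smul (1 / s)
    have hθd' : ∀ y, HasFDerivAt θ ((fderiv ℝ χ ((1 / s) • (y - z))).comp
        ((1 / s) • ContinuousLinearMap.id ℝ E2)) y := fun y =>
      HasFDerivAt.comp (g := χ) y (hχd _).hasFDerivAt (hin y)
    have hθd : ∀ y, DifferentiableAt ℝ θ y := fun y => (hθd' y).differentiableAt
    have hθb : ∀ y, gS θ y ≤ 2 * M := by
      intro y
      have : ‖fderiv ℝ θ y‖ ≤ K / s := by
        rw [(hθd' y).fderiv]
        refine ContinuousLinearMap.opNorm_le_bound _ (by positivity) fun w => ?_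
        simp only [ContinuousLinearMap.comp_apply, ContinuousLinearMap.smul_apply,
          ContinuousLinearMap.id_apply, map_smul]
        rw [norm_smul, Real.norm_of_nonneg (by positivity : (0:ℝ) ≤ 1 / s)]
        calc 1 / s * ‖fderiv ℝ χ ((1 / s) • (y - z)) w‖ ≤ 1 / s * (K * ‖w‖) := by
              gcongr
              exact ((fderiv ℝ χ _).le_opNorm w).trans (by gcongr; exact hχK _)
          _ = K / s * ‖w‖ := by ring
      have := gS_le this
      rwa [div_pow] at this
    have hnorm : ∀ y : E2, ‖(1 / s) • (y - z)‖ = dist y z / s := by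
      intro y
      rw [norm_smul, Real.norm_of_nonneg (by positivity : (0:ℝ) ≤ 1 / s), dist_eq_norm]; ring
    have hθ1 : ∀ y ∈ ball z s, θ y = 1 := by
      intro y hy
      apply hχ1
      rw [hnorm, div_lt_one hspos]; exact hy
    have hθ0 : ∀ y, 2 * s < dist y z → θ y = 0 := by
      intro y hy
      apply hχ2
      rw [hnorm, lt_div_iff₀ hspos]; exact hy
    have hθsq : ∀ y, θ y ^ 2 ≤ 1 := by
      intro y
      have := hχr ((1 / s) • (y - z))
      nlinarith [this.1, this.2]
    set Y : E2 → E2 := fun y => θ y • X y with hY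
    have hYz : ∀ y, y ∉ closedBall z (2 * s) → Y =ᶠ[𝓝 y] fun _ => 0 := by
      intro y hy
      filter_upwards [isClosed_closedBall.isOpen_compl.mem_nhds hy] with w hw
      have hw : w ∉ closedBall z (2 * s) := hw
      rw [mem_closedBall, not_le] at hw
      simp [hY, hθ0 w hw]
    have hXd : ∀ y ∈ Ω, DifferentiableAt ℝ X y := fun y hy => hX.differentiableAt (ho.mem_nhds hy)
    have hYd : DifferentiableOn ℝ Y Ω := fun y hy =>
      ((hθd y).smul (hXd y hy)).differentiableWithinAt
    have hYfin : ∫⁻ y in Ω, ENNReal.ofReal (gradNormSq Y y) < ∞ := by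
      have : ∀ y ∈ Ω, ENNReal.ofReal (gradNormSq Y y) ≤ ENNReal.ofReal 2 * ENNReal.ofReal (gradNormSq X y)
          + ENNReal.ofReal (4 * M) * ENNReal.ofReal (‖X y‖ ^ 2) := by
        intro y hy
        rw [← ENNReal.ofReal_mul (by norm_num), ← ENNReal.ofReal_mul (by positivity),
          ← ENNReal.ofReal_add (mul_nonneg (by norm_num) (gradNormSq_nonneg _ _)) (by positivity)]
        apply ENNReal.ofReal_le_ofReal
        refine (prod_a (hθd y) (hXd y hy)).trans ?_
        have a1 := mul_le_mul_of_nonneg_right (hθsq y) (gradNormSq_nonneg X y)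
        have a2 := mul_le_mul_of_nonneg_right (hθb y) (sq_nonneg ‖X y‖)
        linarith
      refine (setLIntegral_mono' ho.measurableSet this).trans_lt ?_
      rw [lintegral_add_left ((measurable_gradNormSq X).ennreal_ofReal.const_mul _),
        lintegral_const_mul _ (measurable_gradNormSq X).ennreal_ofReal,
        lintegral_const_mul' _ _ ENNReal.ofReal_ne_top]
      exact ENNReal.add_lt_top.2 ⟨ENNReal.mul_lt_top ENNReal.ofReal_lt_top hg,
        ENNReal.mul_lt_top ENNReal.ofReal_lt_top hN⟩
    have hML := local_ML ho hU z hYd (fun y _ hd => by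
      have : θ y = 0 := hθ0 y (by rw [hs]; linarith)
      simp [hY, this]) hYfin
    have mcH : Measurable ((closedBall z (2 * s)).indicator H) := mH.indicator measurableSet_closedBall
    -- pointwise
    have q1 : ∀ y, (ball z s).indicator G y ≤ Ω.indicator (fun y => ENNReal.ofReal 2 *
        ENNReal.ofReal (gradNormSq Y y)) y + ENNReal.ofReal 4 * (closedBall z (2 * s)).indicator H y := by
      intro y
      by_cases hy : y ∈ ball z s
      · have hy2 : y ∈ closedBall z (2 * s) := by
          rw [mem_closedBall]; rw [mem_ball] at hy; linarith
        rw [indicator_of_mem hy, indicator_of_mem hy2]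
        by_cases hyΩ : y ∈ Ω
        · simp only [hG, hH, indicator_of_mem hyΩ]
          rw [← ENNReal.ofReal_mul (by norm_num), ← ENNReal.ofReal_mul (by norm_num),
            ← ENNReal.ofReal_add (mul_nonneg (by norm_num) (gradNormSq_nonneg _ _))
            (mul_nonneg (by norm_num) (add_nonneg (symGradNormSq_nonneg _ _) (by positivity)))]
          apply ENNReal.ofReal_le_ofReal
          have a0 := prod_b (hθd y) (hXd y hyΩ)
          rw [hθ1 y hy, one_pow, one_mul] at a0
          have a2 := mul_le_mul_of_nonneg_right (hθb y) (sq_nonneg ‖X y‖)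
          have a3 := symGradNormSq_nonneg X y
          linarith
        · simp only [hG, indicator_of_notMem hyΩ]; exact zero_le
      · rw [indicator_of_notMem hy]; exact zero_le
    have q2 : ∀ y, Ω.indicator (fun y => ENNReal.ofReal (symGradNormSq Y y)) y ≤ 
        ENNReal.ofReal 4 * (closedBall z (2 * s)).indicator H y := by
      intro y
      by_cases hyΩ : y ∈ Ω
      · by_cases hy : y ∈ closedBall z (2 * s)
        · rw [indicator_of_mem hy, indicator_of_mem hyΩ, hH, indicator_of_mem hyΩ,
            ← ENNReal.ofReal_mul (by norm_num)]
          apply ENNReal.ofReal_le_ofReal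
          refine (prod_c (hθd y) (hXd y hyΩ)).trans ?_
          have a1 := mul_le_mul_of_nonneg_right (hθsq y) (symGradNormSq_nonneg X y)
          have a2 := mul_le_mul_of_nonneg_right (hθb y) (sq_nonneg ‖X y‖)
          have a3 := symGradNormSq_nonneg X y
          linarith
        · rw [indicator_of_mem hyΩ, symGradNormSq_congr (hYz y hy), symGradNormSq_zero]
          simp
      · rw [indicator_of_notMem hyΩ]; exact zero_le
    have r2 : ∫⁻ y in Ω, ENNReal.ofReal (symGradNormSq Y y) ≤ ENNReal.ofReal 4 *
        ∫⁻ y, (closedBall z (2 * s)).indicator H y := by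
      rw [← lintegral_indicator ho.measurableSet, ← lintegral_const_mul _ mcH]
      exact lintegral_mono q2
    have r1 : ∫⁻ y, (ball z s).indicator G y ≤ ENNReal.ofReal 2 *
        (∫⁻ y in Ω, ENNReal.ofReal (gradNormSq Y y)) + ENNReal.ofReal 4 *
        ∫⁻ y, (closedBall z (2 * s)).indicator H y := by
      refine (lintegral_mono q1).trans (le_of_eq ?_)
      rw [lintegral_add_right _ (mcH.const_mul _), lintegral_const_mul _ mcH,
        lintegral_indicator ho.measurableSet,
        lintegral_const_mul _ (measurable_gradNormSq Y).ennreal_ofReal]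
    refine r1.trans ?_
    calc _ ≤ ENNReal.ofReal 2 * (ENNReal.ofReal 400000 * (ENNReal.ofReal 4 *
        ∫⁻ y, (closedBall z (2 * s)).indicator H y)) + ENNReal.ofReal 4 *
        ∫⁻ y, (closedBall z (2 * s)).indicator H y := by
          gcongr
          exact hML.trans (by gcongr)
      _ = ENNReal.ofReal (2 * 400000 * 4 + 4) * ∫⁻ y, (closedBall z (2 * s)).indicator H y := by
          rw [ENNReal.ofReal_add (by norm_num) (by norm_num), ENNReal.ofReal_mul (by norm_num),
            ENNReal.ofReal_mul (by norm_num)]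
          ring
      _ ≤ _ := by gcongr; norm_num
  have T := lintegral_mono (μ := (volume : Measure E2)) hloc
  rw [lintegral_const_mul' _ _ ENNReal.ofReal_ne_top] at T
  rw [tonelli_set mG (fun z => ball z s) (fun y z => by rw [mem_ball, mem_ball, dist_comm])
      (measurableSet_lt (measurable_snd.dist measurable_fst) measurable_const)
      (V := volume (ball (0 : E2) s)) (fun y => Measure.addHaar_ball_center _ _ _)
      (fun _ => measurableSet_ball),
    tonelli_set mH (fun z => closedBall z (2 * s)) (fun y z => by
        rw [mem_closedBall, mem_closedBall, dist_comm])
      (measurableSet_le (measurable_snd.dist measurable_fst) measurable_const)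
      (V := ENNReal.ofReal 4 * volume (ball (0 : E2) s)) (fun y => by
        rw [Measure.addHaar_closedBall_mul _ _ (by norm_num) hspos.le,
          Measure.addHaar_closedBall_eq_addHaar_ball]
        congr 2
        simp; norm_num)
      (fun _ => measurableSet_closedBall)] at T
  have hv0 : volume (ball (0 : E2) s) ≠ 0 := (measure_ball_pos volume _ hspos).ne'
  have hv1 : volume (ball (0 : E2) s) ≠ ∞ := measure_ball_lt_top.ne
  have T2 : ∫⁻ y, G y ≤ ENNReal.ofReal 16000000 * ∫⁻ y, H y := by
    rw [← ENNReal.mul_le_mul_iff_right hv0 hv1]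
    refine T.trans (le_of_eq ?_)
    rw [show (16000000 : ℝ) = 4000000 * 4 by norm_num, ENNReal.ofReal_mul (by norm_num)]
    ring
  rw [← lintegral_indicator ho.measurableSet, ← lintegral_indicator ho.measurableSet]
  refine T2.trans ?_
  rw [← lintegral_const_mul _ mH, ← lintegral_const_mul' _ _ ENNReal.ofReal_ne_top]
  refine lintegral_mono fun y => ?_
  by_cases hy : y ∈ Ω
  · simp only [hH, indicator_of_mem hy]
    rw [← ENNReal.ofReal_mul (by norm_num), ← ENNReal.ofReal_mul (by positivity)]
    apply ENNReal.ofReal_le_ofReal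
    have hMl : M = 256 * K ^ 2 * (1 / l ^ 2) := by rw [hM, hs]; field_simp; norm_num
    rw [hMl]
    have a3 := symGradNormSq_nonneg X y
    have a4 : 1 ≤ 256 * K ^ 2 := by nlinarith
    have a5 := mul_le_mul_of_nonneg_right a4 a3
    calc _ ≤ 16000000 * (256 * K ^ 2 * symGradNormSq X y + 256 * K ^ 2 * (1 / l ^ 2) * ‖X y‖ ^ 2) := by
          linarith
      _ = _ := by ring
  · simp only [hH, indicator_of_notMem hy]; simp

lemma frontier_nonempty {Ω : Set E2} (h : IsUBCDomain Ω) : (frontier Ω).Nonempty := by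
  obtain ⟨ho, hc, hb, -⟩ := h
  rw [nonempty_iff_ne_empty]
  intro he
  rcases (frontier_eq_empty_iff.1 he) with h | h
  · exact hc.nonempty.ne_empty h
  · rw [h] at hb
    exact NormedSpace.unbounded_univ ℝ E2 hb

lemma ubc_bdd {Ω : Set E2} (h : IsUBCDomain Ω) : BddAbove {r : ℝ | IsUBCWith Ω r} := by
  obtain ⟨x, hx⟩ := frontier_nonempty h
  refine ⟨diam Ω, ?_⟩
  rintro r ⟨hr, hb⟩
  obtain ⟨a, b, ha, -, -⟩ := hb x hx
  have h1 : a + (r / 2) • e 0 ∈ Ω := ha (by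
    rw [mem_ball, dist_eq_norm]; simp [norm_smul, norm_e, abs_of_pos hr]; linarith)
  have h2 : a - (r / 2) • e 0 ∈ Ω := ha (by
    rw [mem_ball, dist_eq_norm]; simp [norm_smul, norm_e, abs_of_pos hr]; linarith)
  have h3 := dist_le_diam_of_mem h.2.2.1 h1 h2
  rw [dist_eq_norm, show a + (r / 2) • e 0 - (a - (r / 2) • e 0) = r • e 0 by module,
    norm_smul, norm_e, mul_one, Real.norm_of_nonneg hr.le] at h3
  exact h3

lemma ubc_facts {Ω : Set E2} (h : IsUBCDomain Ω) :
    0 < ubcRadius Ω ∧ ∃ r, IsUBCWith Ω r ∧ ubcRadius Ω / 2 < r := by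
  have hb := ubc_bdd h
  obtain ⟨r0, hr0⟩ := h.2.2.2
  have h1 : r0 ≤ ubcRadius Ω := le_csSup hb hr0
  have hpos : 0 < ubcRadius Ω := hr0.1.trans_le h1
  refine ⟨hpos, ?_⟩
  obtain ⟨r, hr, hlt⟩ := exists_lt_of_lt_csSup ⟨r0, hr0⟩ (show ubcRadius Ω / 2 < sSup {r : ℝ | IsUBCWith Ω r} from by
    show ubcRadius Ω / 2 < ubcRadius Ω
    linarith)
  exact ⟨r, hr, hlt⟩

lemma korn_i : ∃ C : ℝ, 0 < C ∧ ∀ Ω : Set E2, IsUBCDomain Ω →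
    ∀ X : E2 → E2, DifferentiableOn ℝ X Ω →
    ∫⁻ y in Ω, ENNReal.ofReal (gradNormSq X y) < ∞ → ∫⁻ y in Ω, ENNReal.ofReal (‖X y‖ ^ 2) < ∞ →
    ∫⁻ y in Ω, ENNReal.ofReal (gradNormSq X y) ≤ ENNReal.ofReal C *
      ∫⁻ y in Ω, ENNReal.ofReal (symGradNormSq X y + ‖X y‖ ^ 2 / ubcRadius Ω ^ 2) := by
  obtain ⟨C, hC, h⟩ := cover
  refine ⟨C * 400000000, by positivity, ?_⟩
  intro Ω hΩ X hX hg hN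
  obtain ⟨hR, r, hr, hRr⟩ := ubc_facts hΩ
  have hr0 : 0 < r := hr.1
  refine (h Ω (r / 10000) hΩ.1 (by rwa [mul_div_cancel₀ _ (by norm_num)]) X hX hg hN).trans ?_
  rw [ENNReal.ofReal_mul hC.le, mul_assoc]
  gcongr
  rw [← lintegral_const_mul' _ _ ENNReal.ofReal_ne_top]
  refine lintegral_mono fun y => ?_
  rw [← ENNReal.ofReal_mul (by norm_num)]
  apply ENNReal.ofReal_le_ofReal
  have h1 := symGradNormSq_nonneg X y
  have h2 : ‖X y‖ ^ 2 / (r / 10000) ^ 2 ≤ 400000000 * (‖X y‖ ^ 2 / ubcRadius Ω ^ 2) := by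
    have : ubcRadius Ω ^ 2 ≤ 4 * r ^ 2 := by nlinarith
    rw [← mul_div_assoc, div_le_div_iff₀ (by positivity) (by positivity)]
    have h3 := mul_le_mul_of_nonneg_left this (sq_nonneg ‖X y‖)
    nlinarith [h3]
  linarith

lemma hasFDerivAt_squeeze {f g h : E2 → ℝ} {L : E2 →L[ℝ] ℝ} {x : E2} (hf : HasFDerivAt f L x)
    (hh : HasFDerivAt h L x) (h1 : ∀ᶠ y in 𝓝 x, f y ≤ g y) (h2 : ∀ᶠ y in 𝓝 x, g y ≤ h y)
    (e1 : f x = g x) (e2 : h x = g x) : HasFDerivAt g L x := by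
  rw [hasFDerivAt_iff_isLittleO] at *
  refine Asymptotics.IsBigO.trans_isLittleO (Asymptotics.IsBigO.of_bound 1 ?_)
    (hf.norm_left.add hh.norm_left)
  filter_upwards [h1, h2] with y a1 a2
  rw [one_mul, Real.norm_eq_abs, Real.norm_eq_abs, Real.norm_eq_abs, Real.norm_eq_abs, e1, e2]
  refine le_trans ?_ (le_abs_self _)
  rw [abs_le]
  have b1 := neg_abs_le (f y - g x - L (y - x))
  have b2 := le_abs_self (h y - g x - L (y - x))
  have b3 := abs_nonneg (f y - g x - L (y - x))
  have b4 := abs_nonneg (h y - g x - L (y - x))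
  constructor <;> linarith

lemma ball_sep' {c d : E2} {r s : ℝ} (hr : 0 < r) (hs : 0 < s) (h : Disjoint (ball c r) (ball d s)) :
    r + s ≤ ‖c - d‖ := by
  by_contra hlt
  push Not at hlt
  have hh := Set.disjoint_left.1 h
  have hrs : 0 < r + s := by linarith
  refine @hh (c + (r / (r + s)) • (d - c)) ?_ ?_
  · rw [mem_ball, dist_eq_norm, add_sub_cancel_left, norm_smul, Real.norm_of_nonneg (by positivity),
      norm_sub_rev]
    calc r / (r + s) * ‖c - d‖ < r / (r + s) * (r + s) := by gcongr
      _ = r := by field_simp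
  · rw [mem_ball, dist_eq_norm, show c + (r / (r + s)) • (d - c) - d = (s / (r + s)) • (c - d) by
      have : r / (r + s) = 1 - s / (r + s) := by field_simp; ring
      rw [this]; module, norm_smul, Real.norm_of_nonneg (by positivity)]
    calc s / (r + s) * ‖c - d‖ < s / (r + s) * (r + s) := by gcongr
      _ = s := by field_simp

lemma dist_diff {Ω : Set E2} (ho : IsOpen Ω) {r : ℝ} (hU : IsUBCWith Ω r) {x : E2} (hx : x ∈ Ω)
    (hne : (frontier Ω).Nonempty) (hd : infDist x (frontier Ω) < r) :
    DifferentiableAt ℝ (fun y => infDist y (frontier Ω)) x := by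
  have hr := hU.1
  obtain ⟨p, hp, hpd⟩ := (isClosed_frontier (s := Ω)).exists_infDist_eq_dist hne x
  obtain ⟨n, hn, hin, hout⟩ := ubc_normal hU hp
  set d0 := dist x p with hd0
  rw [hpd] at hd
  have hxp : x ≠ p := by
    rintro rfl
    rw [ho.frontier_eq] at hp
    exact hp.2 hx
  have hd0pos : 0 < d0 := dist_pos.2 hxp
  have hball : ball x d0 ⊆ Ω := by
    intro y hy
    have := seg_mem ho (γ := fun t : ℝ => x + t • (y - x)) (by fun_prop) (a := 0) (b := 1) (by
      intro s hs hf
      rw [uIcc_of_le zero_le_one] at hs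
      have h1 := infDist_le_dist_of_mem (x := x) hf
      rw [hpd, dist_eq_norm] at h1
      rw [show x - (x + s • (y - x)) = s • (x - y) by module, norm_smul, Real.norm_of_nonneg hs.1] at h1
      rw [mem_ball, dist_comm, dist_eq_norm] at hy
      nlinarith [hs.2, norm_nonneg (x - y)]) (by simpa using hx)
    simpa using this
  have hsep := ball_sep' hr hd0pos (disjoint_of_subset hout hball disjoint_compl_left)
  have hxe : x = p + d0 • n := by
    have h1 : ‖x - p‖ = d0 := (dist_eq_norm x p).symm
    have h2 : (r + d0) ^ 2 ≤ ‖(x - p) + r • n‖ ^ 2 := by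
      rw [show (x - p) + r • n = -(p - r • n - x) by abel, norm_neg]; gcongr
    rw [norm_add_sq_real, h1, inner_smul_right, norm_smul, hn, Real.norm_of_nonneg hr.le] at h2
    have h3 : d0 ≤ ⟪x - p, n⟫ := by nlinarith
    have h4 : ‖(x - p) - d0 • n‖ ^ 2 ≤ 0 := by
      rw [norm_sub_sq_real, h1, inner_smul_right, norm_smul, hn, Real.norm_of_nonneg hd0pos.le]
      nlinarith
    have h5 : (x - p) - d0 • n = 0 := by
      rw [← norm_eq_zero]; nlinarith [norm_nonneg ((x - p) - d0 • n)]
    rw [sub_eq_zero] at h5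
    rw [← h5]; abel
  set cO := p - r • n with hcO
  set cI := p + r • n with hcI
  have nO : ‖x - cO‖ = r + d0 := by
    rw [hxe, hcO, show p + d0 • n - (p - r • n) = (r + d0) • n by module, norm_smul, hn, mul_one,
      Real.norm_of_nonneg (by linarith)]
  have nI : ‖x - cI‖ = r - d0 := by
    rw [hxe, hcI, show p + d0 • n - (p + r • n) = -((r - d0) • n) by module, norm_neg, norm_smul, hn,
      mul_one, Real.norm_of_nonneg (by linarith)]
  have dO : DifferentiableAt ℝ (fun y => ‖y - cO‖ - r) x := by
    refine (DifferentiableAt.norm ℝ (differentiableAt_id.sub_const cO) ?_).sub_const r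
    intro h; have h : x - cO = 0 := h
    rw [h, norm_zero] at nO; linarith
  have dI : DifferentiableAt ℝ (fun y => r - ‖y - cI‖) x := by
    refine (DifferentiableAt.norm ℝ (differentiableAt_id.sub_const cI) ?_).const_sub r
    intro h; have h : x - cI = 0 := h
    rw [h, norm_zero] at nI; linarith
  have hlow : ∀ y, r - ‖y - cI‖ ≤ infDist y (frontier Ω) := by
    intro y
    rw [le_infDist hne]
    intro q hq
    have h1 := disj_ball_frontier ho (Or.inl hin) hq
    have h2 := norm_sub_le_norm_sub_add_norm_sub q y cI
    rw [dist_comm, dist_eq_norm]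
    linarith
  have hup : ∀ y ∈ Ω, infDist y (frontier Ω) ≤ ‖y - cO‖ - r := by
    intro y hy
    by_cases hh : ∀ s ∈ uIcc (0 : ℝ) 1, y + s • (cO - y) ∉ frontier Ω
    · have := seg_mem ho (γ := fun t : ℝ => y + t • (cO - y)) (by fun_prop) hh (by simpa using hy)
      exfalso
      refine hout (mem_ball_self hr) ?_
      simpa using this
    · push Not at hh
      obtain ⟨s, hs, hf⟩ := hh
      rw [uIcc_of_le zero_le_one] at hs
      have h1 := disj_ball_frontier ho (Or.inr hout) hf
      have h2 := infDist_le_dist_of_mem (x := y) hf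
      rw [dist_eq_norm, show y - (y + s • (cO - y)) = s • (y - cO) by module, norm_smul,
        Real.norm_of_nonneg hs.1] at h2
      rw [show y + s • (cO - y) - cO = (1 - s) • (y - cO) by module, norm_smul,
        Real.norm_of_nonneg (by linarith [hs.2])] at h1
      linarith
  have hder : fderiv ℝ (fun y => r - ‖y - cI‖) x = fderiv ℝ (fun y => ‖y - cO‖ - r) x := by
    have hmin : IsLocalMin (fun y => (‖y - cO‖ - r) - (r - ‖y - cI‖)) x := by
      filter_upwards [ho.mem_nhds hx] with y hy
      have := hup y hy
      have := hlow y
      rw [nO, nI]; linarith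
    have := hmin.fderiv_eq_zero
    rw [fderiv_fun_sub dO dI, sub_eq_zero] at this
    exact this.symm
  have hI := dI.hasFDerivAt
  rw [hder] at hI
  refine (hasFDerivAt_squeeze hI dO.hasFDerivAt (Eventually.of_forall hlow) ?_ ?_ ?_).differentiableAt
  · filter_upwards [ho.mem_nhds hx] with y hy using hup y hy
  · show r - ‖x - cI‖ = infDist x (frontier Ω)
    rw [hpd, nI]; ring
  · show ‖x - cO‖ - r = infDist x (frontier Ω)
    rw [hpd, nO]; ring

lemma dist_fderiv_le {Ω : Set E2} (x : E2) :
    ‖fderiv ℝ (fun y => infDist y (frontier Ω)) x‖ ≤ 1 := by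
  have := norm_fderiv_le_of_lipschitz ℝ (x₀ := x) (lipschitz_infDist_pt (frontier Ω))
  simpa using this

lemma deriv_sq_le {φ : ℝ → ℝ} (hs : ContDiff ℝ (⊤ : ℕ∞) φ) (hc : HasCompactSupport φ)
    (h0 : ∀ s, 0 ≤ φ s) : ∃ M : ℝ, 0 < M ∧ ∀ t, deriv φ t ^ 2 ≤ 4 * M * φ t := by
  have hs2 : ContDiff ℝ 2 φ := hs.of_le (show ((2 : ℕ∞) : WithTop ℕ∞) ≤ _ from WithTop.coe_le_coe.2 le_top)
  have hd1 : ContDiff ℝ 1 (deriv φ) := by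
    have := (contDiff_succ_iff_deriv (n := 1) (f := φ)).1 (by rw [one_add_one_eq_two]; exact hs2)
    exact this.2.2
  have hdc : HasCompactSupport (deriv (deriv φ)) := hc.deriv.deriv
  obtain ⟨M0, hM0⟩ := (hd1.continuous_deriv le_rfl).bounded_above_of_compact_support hdc
  set M := max M0 1 with hM
  have hMpos : 0 < M := lt_of_lt_of_le one_pos (le_max_right _ _)
  have hlip : ∀ s t, |deriv φ s - deriv φ t| ≤ M * |s - t| := by
    intro s t
    have := convex_univ.norm_image_sub_le_of_norm_deriv_le (f := deriv φ) (C := M)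
      (fun x _ => hd1.differentiable one_ne_zero x) (fun x _ => (hM0 x).trans (le_max_left _ _))
      (mem_univ t) (mem_univ s)
    simpa using this
  have hφd : Differentiable ℝ φ := hs2.differentiable two_ne_zero
  have key : ∀ t h, φ (t + h) ≤ φ t + h * deriv φ t + M * h ^ 2 := by
    intro t h
    have hd : ∀ s, HasDerivAt (fun s => φ s - deriv φ t * s) (deriv φ s - deriv φ t) s := by
      intro s
      have := (hφd s).hasDerivAt.fun_sub ((hasDerivAt_id s).const_mul (deriv φ t))
      simpa using this
    have := (convex_closedBall t |h|).norm_image_sub_le_of_norm_hasDerivWithin_le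
      (f := fun s => φ s - deriv φ t * s) (f' := fun s => deriv φ s - deriv φ t) (C := M * |h|)
      (fun s _ => (hd s).hasDerivWithinAt) (fun s hs => by
        refine (hlip s t).trans ?_
        rw [mem_closedBall, Real.dist_eq] at hs
        gcongr) (mem_closedBall_self (abs_nonneg h)) (y := t + h) (by
          rw [mem_closedBall, Real.dist_eq]; simp)
    rw [Real.norm_eq_abs, Real.norm_eq_abs, add_sub_cancel_left, mul_assoc, abs_mul_abs_self] at this
    have := (abs_le.1 this).2
    nlinarith
  refine ⟨M, hMpos, fun t => ?_⟩
  have h1 := key t (-(deriv φ t) / (2 * M))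
  have h2 := h0 (t + -(deriv φ t) / (2 * M))
  have h3 : -(deriv φ t) / (2 * M) * deriv φ t + M * (-(deriv φ t) / (2 * M)) ^ 2 =
      -(deriv φ t ^ 2) / (4 * M) := by field_simp; ring
  have h4 : deriv φ t ^ 2 / (4 * M) ≤ φ t := by
    have : -(deriv φ t ^ 2) / (4 * M) = -(deriv φ t ^ 2 / (4 * M)) := by ring
    linarith
  rw [div_le_iff₀ (by positivity)] at h4
  linarith

/-- truncation -/
def Tk (κ w : ℝ) : ℝ := (max (w - κ) 0) ^ 2 / w

lemma hasDerivAt_maxsq (x : ℝ) : HasDerivAt (fun x : ℝ => (max x 0) ^ 2) (2 * max x 0) x := by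
  rcases lt_trichotomy x 0 with h | h | h
  · have : (fun x : ℝ => (max x 0) ^ 2) =ᶠ[𝓝 x] fun _ => 0 := by
      filter_upwards [gt_mem_nhds h] with y hy
      rw [max_eq_right (le_of_lt hy)]; simp
    rw [max_eq_right h.le, mul_zero]
    exact (hasDerivAt_const x (0 : ℝ)).congr_of_eventuallyEq this
  · subst h
    rw [max_self, mul_zero, hasDerivAt_iff_isLittleO]
    have h2 : (fun x : ℝ => x ^ 2) =o[𝓝 0] fun x : ℝ => x := by
      have := Asymptotics.isLittleO_pow_pow (𝕜 := ℝ) (m := 1) (n := 2) (by norm_num)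
      simpa using this
    simp only [sub_zero, max_self, smul_zero]
    refine Asymptotics.IsBigO.trans_isLittleO (Asymptotics.IsBigO.of_bound 1 ?_) h2
    filter_upwards with y
    rw [one_mul, Real.norm_eq_abs, Real.norm_eq_abs]
    rcases le_total y 0 with h | h
    · rw [max_eq_right h]; simp [sq_nonneg]
    · rw [max_eq_left h]; simp
  · have : (fun x : ℝ => (max x 0) ^ 2) =ᶠ[𝓝 x] fun x => x ^ 2 := by
      filter_upwards [lt_mem_nhds h] with y hy
      rw [max_eq_left (le_of_lt hy)]
    rw [max_eq_left h.le]
    have := (hasDerivAt_pow 2 x).congr_of_eventuallyEq this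
    simpa using this

lemma Tk_deriv {κ w : ℝ} (hκ : 0 ≤ κ) (hw : 0 < w) : ∃ c, HasDerivAt (Tk κ) c w ∧ |c| ≤ 1 := by
  have h1 : HasDerivAt (fun w : ℝ => (max (w - κ) 0) ^ 2) (2 * max (w - κ) 0) w := by
    have := (hasDerivAt_maxsq (w - κ)).comp w ((hasDerivAt_id w).sub_const κ)
    simpa [Function.comp_def] using this
  refine ⟨(2 * max (w - κ) 0 * w - (max (w - κ) 0) ^ 2 * 1) / w ^ 2,
    h1.div (hasDerivAt_id w) hw.ne', ?_⟩
  set m := max (w - κ) 0 with hm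
  have m0 : 0 ≤ m := le_max_right _ _
  have m1 : m ≤ w := max_le (by linarith) hw.le
  rw [abs_of_nonneg (div_nonneg (by nlinarith) (by positivity)), div_le_one (by positivity)]
  nlinarith [sq_nonneg (m - w)]

lemma Tk_zero {κ w : ℝ} (h : w ≤ κ) : Tk κ w = 0 := by
  unfold Tk; rw [max_eq_right (by linarith)]; simp

lemma Tk_sq_le {κ w : ℝ} (hκ : 0 ≤ κ) (hw : 0 ≤ w) : Tk κ w ^ 2 ≤ w ^ 2 := by
  unfold Tk
  rcases hw.eq_or_lt with h | h
  · rw [← h]; simp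
  set m := max (w - κ) 0 with hm
  have m0 : 0 ≤ m := le_max_right _ _
  have m1 : m ≤ w := max_le (by linarith) hw
  have : m ^ 2 / w ≤ w := by
    rw [div_le_iff₀ h]; nlinarith
  gcongr

lemma Tk_tendsto {w : ℝ} (hw : 0 ≤ w) :
    Tendsto (fun k : ℕ => Tk (1 / ((k : ℝ) + 1)) w ^ 2) atTop (𝓝 (w ^ 2)) := by
  have h1 : Tendsto (fun k : ℕ => 1 / ((k : ℝ) + 1)) atTop (𝓝 0) := tendsto_one_div_add_atTop_nhds_zero_nat
  have h2 : Continuous fun κ : ℝ => Tk κ w ^ 2 := by unfold Tk; fun_prop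
  have h3 := (h2.tendsto 0).comp h1
  have h4 : Tk 0 w ^ 2 = w ^ 2 := by
    unfold Tk
    rw [sub_zero, max_eq_left hw]
    rcases hw.eq_or_lt with h | h
    · rw [← h]; simp
    · congr 1; field_simp
  rw [h4] at h3
  exact h3

lemma Tk_measurable (κ : ℝ) : Measurable (Tk κ) := by
  unfold Tk; fun_prop

lemma korn_ii (φ : ℝ → ℝ)
    (hφ_smooth : ContDiff ℝ (⊤ : ℕ∞) φ) (hφ_supp : HasCompactSupport φ)
    (hφ_range : ∀ s : ℝ, 0 ≤ φ s ∧ φ s ≤ 1)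
    (hφ_zero : ∀ s : ℝ, 1/2 < s → φ s = 0) :
    ∃ C : ℝ, 0 < C ∧ ∀ Ω : Set E2, IsUBCDomain Ω → ∀ (X : E2 → E2) (T : Set E2),
      DifferentiableOn ℝ X (Ω ∩ tubNbhd Ω (ubcRadius Ω / 2)) →
      (∀ y ∈ Ω, φ (infDist y (frontier Ω) / ubcRadius Ω) ≠ 0 → y ∈ T) →
      ∫⁻ y in Ω, ENNReal.ofReal (T.indicator (fun y => ‖X y‖ ^ 2) y) < ∞ →
      ∫⁻ y in Ω, ENNReal.ofReal (φ (infDist y (frontier Ω) / ubcRadius Ω) * gradNormSq X y) < ∞ →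
      ∫⁻ y in Ω, ENNReal.ofReal (φ (infDist y (frontier Ω) / ubcRadius Ω) * gradNormSq X y) ≤
        ENNReal.ofReal C * ∫⁻ y in Ω, ENNReal.ofReal
          (φ (infDist y (frontier Ω) / ubcRadius Ω) * symGradNormSq X y +
            T.indicator (fun y => ‖X y‖ ^ 2) y / ubcRadius Ω ^ 2) := by
  obtain ⟨C, hC, hk⟩ := korn_i
  obtain ⟨M, hM, hMφ⟩ := deriv_sq_le hφ_smooth hφ_supp fun s => (hφ_range s).1
  have hφd : Differentiable ℝ φ := hφ_smooth.differentiable (by simp)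
  have hφc : Continuous φ := hφd.continuous
  have hφhalf : ∀ s, 1 / 2 ≤ s → φ s = 0 := by
    intro s hs
    have hcl : IsClosed {s | φ s = 0} := isClosed_eq hφc continuous_const
    have h1 : Ioi (1 / 2 : ℝ) ⊆ {s | φ s = 0} := fun s hs => hφ_zero s hs
    have h2 := hcl.closure_subset_iff.2 h1
    rw [closure_Ioi] at h2
    exact h2 hs
  refine ⟨2 * C * (3 + 4 * M) + 4 * M, by positivity, ?_⟩
  intro Ω hΩ X T hX hT hN hg
  have ho := hΩ.1
  obtain ⟨hR, r, hr, hRr⟩ := ubc_facts hΩ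
  have hne := frontier_nonempty hΩ
  set R := ubcRadius Ω with hRdef
  set d : E2 → ℝ := fun y => infDist y (frontier Ω) with hd
  have hdc : Continuous d := continuous_infDist_pt _
  set ψ : E2 → ℝ := fun y => φ (d y / R) with hψ
  have hψc : Continuous ψ := hφc.comp (hdc.div_const R)
  have hψ0 : ∀ y, 0 ≤ ψ y := fun y => (hφ_range _).1
  have hψ1 : ∀ y, ψ y ≤ 1 := fun y => (hφ_range _).2
  set N : E2 → ℝ := T.indicator (fun y => ‖X y‖ ^ 2) with hNd
  have hN0 : ∀ y, 0 ≤ N y := fun y => indicator_nonneg (fun _ _ => sq_nonneg _) y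
  have hNX : ∀ y ∈ Ω, ψ y ≠ 0 → N y = ‖X y‖ ^ 2 := fun y hy h => indicator_of_mem (hT y hy h) _
  have htub : ∀ y, ψ y ≠ 0 → d y < R / 2 := by
    intro y h
    by_contra hle
    push Not at hle
    refine h (hφhalf _ ?_)
    rw [le_div_iff₀ hR]; linarith
  have hopen : IsOpen (Ω ∩ tubNbhd Ω (R / 2)) := ho.inter (isOpen_lt hdc continuous_const)
  have hXd : ∀ y ∈ Ω, ψ y ≠ 0 → DifferentiableAt ℝ X y := fun y hy h =>
    hX.differentiableAt (hopen.mem_nhds ⟨hy, htub y h⟩)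
  have main : ∀ κ : ℝ, 0 < κ → ∫⁻ y in Ω, ENNReal.ofReal (Tk κ (√(ψ y)) ^ 2 * gradNormSq X y) ≤
      ENNReal.ofReal (2 * C * (3 + 4 * M) + 4 * M) *
        ∫⁻ y in Ω, ENNReal.ofReal (ψ y * symGradNormSq X y + N y / R ^ 2) := by
    intro κ hκ
    set θ : E2 → ℝ := fun y => Tk κ (√(ψ y)) with hθ
    have hθsq : ∀ y, θ y ^ 2 ≤ ψ y := by
      intro y
      have := Tk_sq_le hκ.le (Real.sqrt_nonneg (ψ y))
      rwa [Real.sq_sqrt (hψ0 y)] at this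
    have hθz : ∀ y, ψ y = 0 → ∀ᶠ w in 𝓝 y, θ w = 0 := by
      intro y hy
      have hc2 : Continuous fun w => √(ψ w) := hψc.sqrt
      have : ∀ᶠ w in 𝓝 y, √(ψ w) < κ := hc2.continuousAt.eventually (gt_mem_nhds (by
        show √(ψ y) < κ
        rw [hy, Real.sqrt_zero]; exact hκ))
      filter_upwards [this] with w hw
      exact Tk_zero hw.le
    have hθd : ∀ y ∈ Ω, ψ y ≠ 0 → DifferentiableAt ℝ θ y ∧ gS θ y ≤ 2 * (√M / R) ^ 2 := by
      intro y hy h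
      have hpos : 0 < ψ y := lt_of_le_of_ne (hψ0 y) (Ne.symm h)
      have hspos : 0 < √(ψ y) := Real.sqrt_pos.2 hpos
      obtain ⟨c, hc, hc1⟩ := Tk_deriv hκ.le hspos
      have h1 : HasDerivAt (fun t => √(φ t)) (deriv φ (d y / R) / (2 * √(ψ y))) (d y / R) :=
        (hφd _).hasDerivAt.sqrt h
      have h2 : HasDerivAt (fun t => Tk κ (√(φ t))) (c * (deriv φ (d y / R) / (2 * √(ψ y)))) (d y / R) :=
        HasDerivAt.comp (h₂ := Tk κ) (h := fun t => √(φ t)) _ hc h1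
      have h3 : DifferentiableAt ℝ d y := dist_diff ho hr hy hne (lt_trans (htub y h) hRr)
      have h4 : HasFDerivAt (fun w => d w / R) (R⁻¹ • fderiv ℝ d y) y := by
        have := h3.hasFDerivAt.const_mul R⁻¹
        simpa only [div_eq_inv_mul] using this
      have h5 : HasFDerivAt θ ((c * (deriv φ (d y / R) / (2 * √(ψ y)))) • (R⁻¹ • fderiv ℝ d y)) y :=
        HasDerivAt.comp_hasFDerivAt (h₂ := fun t => Tk κ (√(φ t))) (f := fun w => d w / R) y h2 h4
      refine ⟨h5.differentiableAt, gS_le ?_⟩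
      rw [h5.fderiv, norm_smul, norm_smul, Real.norm_eq_abs, abs_mul, norm_inv, Real.norm_of_nonneg hR.le]
      have h6 : |deriv φ (d y / R) / (2 * √(ψ y))| ≤ √M := by
        apply Real.abs_le_sqrt
        rw [div_pow, mul_pow, Real.sq_sqrt hpos.le, div_le_iff₀ (by positivity)]
        have := hMφ (d y / R)
        have e : φ (d y / R) = ψ y := rfl
        rw [e] at this
        linarith
      have h7 : ‖fderiv ℝ d y‖ ≤ 1 := dist_fderiv_le y
      calc |c| * |deriv φ (d y / R) / (2 * √(ψ y))| * (R⁻¹ * ‖fderiv ℝ d y‖) ≤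
          1 * √M * (R⁻¹ * 1) := by gcongr
        _ = √M / R := by ring
    have hB : 2 * (√M / R) ^ 2 = 2 * M / R ^ 2 := by
      rw [div_pow, Real.sq_sqrt hM.le]; ring
    rw [hB] at hθd
    set Y : E2 → E2 := fun y => θ y • X y with hY
    have hYz : ∀ y, ψ y = 0 → Y =ᶠ[𝓝 y] fun _ => 0 := by
      intro y hy
      filter_upwards [hθz y hy] with w hw
      simp [hY, hw]
    have hYd : DifferentiableOn ℝ Y Ω := by
      intro y hy
      apply DifferentiableAt.differentiableWithinAt
      by_cases h : ψ y = 0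
      · exact (differentiableAt_const (0 : E2)).congr_of_eventuallyEq (hYz y h)
      · exact (hθd y hy h).1.smul (hXd y hy h)
    have pY : ∀ y ∈ Ω, ‖Y y‖ ^ 2 ≤ N y := by
      intro y hy
      by_cases h : ψ y = 0
      · rw [(hYz y h).self_of_nhds]; simp [hN0 y]
      · rw [hNX y hy h, hY]
        simp only [norm_smul, mul_pow, Real.norm_eq_abs, sq_abs]
        have := mul_le_mul_of_nonneg_right ((hθsq y).trans (hψ1 y)) (sq_nonneg ‖X y‖)
        linarith
    have pa : ∀ y ∈ Ω, gradNormSq Y y ≤ 2 * (ψ y * gradNormSq X y) + 4 * M / R ^ 2 * N y := by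
      intro y hy
      by_cases h : ψ y = 0
      · rw [gradNormSq_congr (hYz y h), gradNormSq_zero, h]
        have := hN0 y
        simp; positivity
      · refine (prod_a (hθd y hy h).1 (hXd y hy h)).trans ?_
        have a1 := mul_le_mul_of_nonneg_right (hθsq y) (gradNormSq_nonneg X y)
        have a2 := mul_le_mul_of_nonneg_right (hθd y hy h).2 (sq_nonneg ‖X y‖)
        rw [hNX y hy h]
        have : 4 * M / R ^ 2 = 2 * (2 * M / R ^ 2) := by ring
        rw [this]; linarith
    have pb : ∀ y ∈ Ω, θ y ^ 2 * gradNormSq X y ≤ 2 * gradNormSq Y y + 4 * M / R ^ 2 * N y := by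
      intro y hy
      by_cases h : ψ y = 0
      · rw [(hθz y h).self_of_nhds]
        have := hN0 y
        have := gradNormSq_nonneg Y y
        simp; positivity
      · refine (prod_b (hθd y hy h).1 (hXd y hy h)).trans ?_
        have a2 := mul_le_mul_of_nonneg_right (hθd y hy h).2 (sq_nonneg ‖X y‖)
        rw [hNX y hy h]
        have : 4 * M / R ^ 2 = 2 * (2 * M / R ^ 2) := by ring
        rw [this]; linarith
    have pc : ∀ y ∈ Ω, symGradNormSq Y y + ‖Y y‖ ^ 2 / R ^ 2 ≤
        (3 + 4 * M) * (ψ y * symGradNormSq X y + N y / R ^ 2) := by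
      intro y hy
      have b1 := mul_nonneg (hψ0 y) (symGradNormSq_nonneg X y)
      have b2 : ‖Y y‖ ^ 2 / R ^ 2 ≤ N y / R ^ 2 := by gcongr; exact pY y hy
      have b3 : 0 ≤ N y / R ^ 2 := div_nonneg (hN0 y) (by positivity)
      have b4 : symGradNormSq Y y ≤ 2 * (ψ y * symGradNormSq X y) + 4 * M * (N y / R ^ 2) := by
        by_cases h : ψ y = 0
        · rw [symGradNormSq_congr (hYz y h), symGradNormSq_zero]
          positivity
        · refine (prod_c (hθd y hy h).1 (hXd y hy h)).trans ?_
          have a1 := mul_le_mul_of_nonneg_right (hθsq y) (symGradNormSq_nonneg X y)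
          have a2 := mul_le_mul_of_nonneg_right (hθd y hy h).2 (sq_nonneg ‖X y‖)
          rw [hNX y hy h]
          have : 4 * M * (‖X y‖ ^ 2 / R ^ 2) = 2 * (2 * M / R ^ 2 * ‖X y‖ ^ 2) := by ring
          rw [this]; linarith
      nlinarith [mul_nonneg hM.le b1, mul_nonneg hM.le b3]
    have fY : ∫⁻ y in Ω, ENNReal.ofReal (‖Y y‖ ^ 2) < ∞ :=
      (setLIntegral_mono' ho.measurableSet fun y hy => ENNReal.ofReal_le_ofReal (pY y hy)).trans_lt hN
    have mψg : Measurable fun y => ENNReal.ofReal (ψ y * gradNormSq X y) :=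
      (hψc.measurable.mul (measurable_gradNormSq X)).ennreal_ofReal
    have fG : ∫⁻ y in Ω, ENNReal.ofReal (gradNormSq Y y) < ∞ := by
      have : ∀ y ∈ Ω, ENNReal.ofReal (gradNormSq Y y) ≤ ENNReal.ofReal 2 *
          ENNReal.ofReal (ψ y * gradNormSq X y) + ENNReal.ofReal (4 * M / R ^ 2) * ENNReal.ofReal (N y) := by
        intro y hy
        rw [← ENNReal.ofReal_mul (by norm_num), ← ENNReal.ofReal_mul (by positivity),
          ← ENNReal.ofReal_add (mul_nonneg (by norm_num) (mul_nonneg (hψ0 y) (gradNormSq_nonneg _ _)))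
            (mul_nonneg (by positivity) (hN0 y))]
        exact ENNReal.ofReal_le_ofReal (pa y hy)
      refine (setLIntegral_mono' ho.measurableSet this).trans_lt ?_
      rw [lintegral_add_left (mψg.const_mul _), lintegral_const_mul _ mψg,
        lintegral_const_mul' _ _ ENNReal.ofReal_ne_top]
      exact ENNReal.add_lt_top.2 ⟨ENNReal.mul_lt_top ENNReal.ofReal_lt_top hg,
        ENNReal.mul_lt_top ENNReal.ofReal_lt_top hN⟩
    have K1 := hk Ω hΩ Y hYd fG fY
    have K2 : ∫⁻ y in Ω, ENNReal.ofReal (symGradNormSq Y y + ‖Y y‖ ^ 2 / R ^ 2) ≤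
        ENNReal.ofReal (3 + 4 * M) *
          ∫⁻ y in Ω, ENNReal.ofReal (ψ y * symGradNormSq X y + N y / R ^ 2) := by
      rw [← lintegral_const_mul' _ _ ENNReal.ofReal_ne_top]
      refine setLIntegral_mono' ho.measurableSet fun y hy => ?_
      rw [← ENNReal.ofReal_mul (by positivity)]
      exact ENNReal.ofReal_le_ofReal (pc y hy)
    have K3 : ∫⁻ y in Ω, ENNReal.ofReal (θ y ^ 2 * gradNormSq X y) ≤ ENNReal.ofReal 2 *
        (∫⁻ y in Ω, ENNReal.ofReal (gradNormSq Y y)) + ENNReal.ofReal (4 * M) *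
        ∫⁻ y in Ω, ENNReal.ofReal (ψ y * symGradNormSq X y + N y / R ^ 2) := by
      have mY := (measurable_gradNormSq Y).ennreal_ofReal
      rw [← lintegral_const_mul' (ENNReal.ofReal (4 * M)) _ ENNReal.ofReal_ne_top,
        ← lintegral_const_mul _ mY, ← lintegral_add_left (mY.const_mul _)]
      refine setLIntegral_mono' ho.measurableSet fun y hy => ?_
      have b1 := mul_nonneg (hψ0 y) (symGradNormSq_nonneg X y)
      have b3 : 0 ≤ N y / R ^ 2 := div_nonneg (hN0 y) (by positivity)
      rw [← ENNReal.ofReal_mul (by norm_num), ← ENNReal.ofReal_mul (by positivity),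
          ← ENNReal.ofReal_add (mul_nonneg (by norm_num) (gradNormSq_nonneg _ _))
            (mul_nonneg (by positivity) (add_nonneg b1 b3))]
      apply ENNReal.ofReal_le_ofReal
      refine (pb y hy).trans ?_
      have : 4 * M / R ^ 2 * N y = 4 * M * (N y / R ^ 2) := by ring
      rw [this]
      nlinarith [mul_nonneg hM.le b1]
    refine K3.trans ?_
    calc _ ≤ ENNReal.ofReal 2 * (ENNReal.ofReal C * (ENNReal.ofReal (3 + 4 * M) *
          ∫⁻ y in Ω, ENNReal.ofReal (ψ y * symGradNormSq X y + N y / R ^ 2))) + ENNReal.ofReal (4 * M) *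
        ∫⁻ y in Ω, ENNReal.ofReal (ψ y * symGradNormSq X y + N y / R ^ 2) := by
          gcongr
          exact K1.trans (by gcongr)
      _ = _ := by
          have z1 : ENNReal.ofReal (2 * C * (3 + 4 * M) + 4 * M) =
              ENNReal.ofReal 2 * ENNReal.ofReal C * ENNReal.ofReal (3 + 4 * M) + ENNReal.ofReal (4 * M) := by
            rw [← ENNReal.ofReal_mul (by norm_num), ← ENNReal.ofReal_mul (by positivity),
              ← ENNReal.ofReal_add (by positivity) (by positivity)]
          rw [z1]
          ring
  -- Fatou
  have hmeas : ∀ k : ℕ, Measurable fun y =>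
      ENNReal.ofReal (Tk (1 / ((k : ℝ) + 1)) (√(ψ y)) ^ 2 * gradNormSq X y) := by
    intro k
    have : Measurable fun y => Tk (1 / ((k : ℝ) + 1)) (√(ψ y)) :=
      (Tk_measurable _).comp hψc.sqrt.measurable
    exact ((this.pow_const 2).mul (measurable_gradNormSq X)).ennreal_ofReal
  have hlim : ∀ y, liminf (fun k : ℕ =>
      ENNReal.ofReal (Tk (1 / ((k : ℝ) + 1)) (√(ψ y)) ^ 2 * gradNormSq X y)) atTop =
      ENNReal.ofReal (ψ y * gradNormSq X y) := by
    intro y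
    apply Tendsto.liminf_eq
    have := Tk_tendsto (Real.sqrt_nonneg (ψ y))
    rw [Real.sq_sqrt (hψ0 y)] at this
    exact ENNReal.tendsto_ofReal (this.mul_const _)
  calc ∫⁻ y in Ω, ENNReal.ofReal (ψ y * gradNormSq X y) 
      = ∫⁻ y in Ω, liminf (fun k : ℕ =>
      ENNReal.ofReal (Tk (1 / ((k : ℝ) + 1)) (√(ψ y)) ^ 2 * gradNormSq X y)) atTop := by
        simp only [hlim]
    _ ≤ liminf (fun k : ℕ => ∫⁻ y in Ω,
      ENNReal.ofReal (Tk (1 / ((k : ℝ) + 1)) (√(ψ y)) ^ 2 * gradNormSq X y)) atTop :=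
        lintegral_liminf_le hmeas
    _ ≤ liminf (fun _ : ℕ => ENNReal.ofReal (2 * C * (3 + 4 * M) + 4 * M) *
        ∫⁻ y in Ω, ENNReal.ofReal (ψ y * symGradNormSq X y + N y / R ^ 2)) atTop :=
        liminf_le_liminf (Eventually.of_forall fun k => main _ (by positivity))
    _ = _ := liminf_const _

/-- Lemma 2.9, quantified Korn inequalities: for UBC domains,
`∫_Ω |∇X|² ≤ C(∫_Ω |∇_sym X|² + r_Ω⁻² ∫_Ω |X|²)`, and the same with the cutoff
`η = φ ∘ (d_Ω / r_Ω)` built from a fixed symmetric bump function `φ`. -/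
theorem quantified_korn (φ : ℝ → ℝ)
    (hφ_smooth : ContDiff ℝ (⊤ : ℕ∞) φ) (hφ_supp : HasCompactSupport φ)
    (hφ_symm : ∀ s : ℝ, φ (-s) = φ s)
    (hφ_range : ∀ s : ℝ, 0 ≤ φ s ∧ φ s ≤ 1)
    (hφ_mono : AntitoneOn φ (Ioi (0:ℝ)))
    (hφ_one : ∀ s ∈ Ioo (0:ℝ) (1/4 : ℝ), φ s = 1)
    (hφ_zero : ∀ s : ℝ, 1/2 < s → φ s = 0) :
    ∃ C : ℝ, ∀ Ω : Set E2, IsUBCDomain Ω →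
      (∀ X : E2 → E2, DifferentiableOn ℝ X Ω →
        IntegrableOn (fun x => ‖X x‖^2) Ω →
        IntegrableOn (fun x => gradNormSq X x) Ω →
        (∫ x in Ω, gradNormSq X x) ≤
          C * ((∫ x in Ω, symGradNormSq X x) +
            (∫ x in Ω, ‖X x‖^2) / (ubcRadius Ω)^2)) ∧
      (∀ X : E2 → E2,
        DifferentiableOn ℝ X (Ω ∩ tubNbhd Ω (ubcRadius Ω / 2)) →
        IntegrableOn (fun x => ‖X x‖^2)
          (Ω ∩ tsupport (fun y => φ (sdist Ω y / ubcRadius Ω))) →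
        IntegrableOn (fun x => φ (sdist Ω x / ubcRadius Ω) * gradNormSq X x) Ω →
        (∫ x in Ω, φ (sdist Ω x / ubcRadius Ω) * gradNormSq X x) ≤
          C * ((∫ x in Ω, φ (sdist Ω x / ubcRadius Ω) * symGradNormSq X x) +
            (∫ x in Ω ∩ tsupport (fun y => φ (sdist Ω y / ubcRadius Ω)), ‖X x‖^2) /
              (ubcRadius Ω)^2)) := by
  obtain ⟨C1, hC1, h1⟩ := korn_i
  obtain ⟨C2, hC2, h2⟩ := korn_ii φ hφ_smooth hφ_supp hφ_range hφ_zero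
  have conv : ∀ (Ω : Set E2) (C C' R : ℝ) (G S N : E2 → ℝ), MeasurableSet Ω → 0 < C → C ≤ C' →
      (∀ y, 0 ≤ G y) → (∀ y, 0 ≤ S y) → (∀ y, 0 ≤ N y) → IntegrableOn G Ω → IntegrableOn S Ω →
      IntegrableOn N Ω →
      ∫⁻ y in Ω, ENNReal.ofReal (G y) ≤ ENNReal.ofReal C * ∫⁻ y in Ω, ENNReal.ofReal (S y + N y / R ^ 2) →
      ∫ y in Ω, G y ≤ C' * ((∫ y in Ω, S y) + (∫ y in Ω, N y) / R ^ 2) := by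
    intro Ω C C' R G S N hm hC hCC hG hS hN iG iS iN h
    have hSN : ∀ y, 0 ≤ S y + N y / R ^ 2 := fun y => add_nonneg (hS y) (div_nonneg (hN y) (sq_nonneg R))
    have iD : Integrable (fun y => N y / R ^ 2) (volume.restrict Ω) := Integrable.div_const iN _
    have iSN : Integrable (fun y => S y + N y / R ^ 2) (volume.restrict Ω) := Integrable.add iS iD
    rw [← ofReal_integral_eq_lintegral_ofReal iG (ae_of_all _ hG),
      ← ofReal_integral_eq_lintegral_ofReal iSN (ae_of_all _ hSN), ← ENNReal.ofReal_mul hC.le,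
      ENNReal.ofReal_le_ofReal_iff (mul_nonneg hC.le (integral_nonneg hSN))] at h
    have e1 : ∫ y in Ω, (S y + N y / R ^ 2) = (∫ y in Ω, S y) + (∫ y in Ω, N y) / R ^ 2 := by
      rw [integral_add iS iD, integral_div]
    rw [← e1]
    exact h.trans (mul_le_mul_of_nonneg_right hCC (integral_nonneg hSN))
  refine ⟨max C1 C2, fun Ω hΩ => ⟨?_, ?_⟩⟩
  · intro X hX iN iG
    have iS : IntegrableOn (fun x => symGradNormSq X x) Ω := by
      refine Integrable.mono' iG (measurable_symGradNormSq X).aestronglyMeasurable (ae_of_all _ fun y => ?_)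
      rw [Real.norm_of_nonneg (symGradNormSq_nonneg X y)]
      exact symGradNormSq_le X y
    exact conv Ω C1 _ _ _ _ _ hΩ.1.measurableSet hC1 (le_max_left _ _) (gradNormSq_nonneg X)
      (symGradNormSq_nonneg X) (fun _ => sq_nonneg _) iG iS iN
      (h1 Ω hΩ X hX (Integrable.lintegral_lt_top iG) (Integrable.lintegral_lt_top iN))
  · intro X hX iN iG
    set T := tsupport (fun y => φ (sdist Ω y / ubcRadius Ω)) with hT
    have mΩ := hΩ.1.measurableSet
    have hTm : MeasurableSet T := (isClosed_tsupport _).measurableSet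
    have hηψ : ∀ y ∈ Ω, φ (sdist Ω y / ubcRadius Ω) = φ (infDist y (frontier Ω) / ubcRadius Ω) := by
      intro y hy
      simp only [sdist, if_pos hy]
      rw [neg_div, hφ_symm]
    have mψ : Measurable fun y => φ (infDist y (frontier Ω) / ubcRadius Ω) :=
      (hφ_smooth.continuous.comp ((continuous_infDist_pt _).div_const _)).measurable
    have c1 : ∀ F : E2 → ℝ, ∫ y in Ω, φ (sdist Ω y / ubcRadius Ω) * F y =
        ∫ y in Ω, φ (infDist y (frontier Ω) / ubcRadius Ω) * F y := fun F =>
      setIntegral_congr_fun mΩ fun y hy => by simp only [hηψ y hy]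
    have iG' : IntegrableOn (fun y => φ (infDist y (frontier Ω) / ubcRadius Ω) * gradNormSq X y) Ω :=
      iG.congr_fun (fun y hy => by simp only [hηψ y hy]) mΩ
    have iS : IntegrableOn (fun y => φ (infDist y (frontier Ω) / ubcRadius Ω) * symGradNormSq X y) Ω := by
      refine Integrable.mono' iG' (mψ.mul (measurable_symGradNormSq X)).aestronglyMeasurable
        (ae_of_all _ fun y => ?_)
      rw [Real.norm_of_nonneg (mul_nonneg (hφ_range _).1 (symGradNormSq_nonneg X y))]
      exact mul_le_mul_of_nonneg_left (symGradNormSq_le X y) (hφ_range _).1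
    have iN' : IntegrableOn (T.indicator fun y => ‖X y‖ ^ 2) Ω := by
      rw [IntegrableOn, integrable_indicator_iff hTm, IntegrableOn, Measure.restrict_restrict hTm,
        inter_comm]
      exact iN
    rw [c1, c1, ← setIntegral_indicator hTm]
    refine conv Ω C2 _ _ _ _ _ mΩ hC2 (le_max_right _ _)
      (fun y => mul_nonneg (hφ_range _).1 (gradNormSq_nonneg X y))
      (fun y => mul_nonneg (hφ_range _).1 (symGradNormSq_nonneg X y))
      (fun y => indicator_nonneg (fun _ _ => sq_nonneg _) y) iG' iS iN'
      (h2 Ω hΩ X T hX ?_ (Integrable.lintegral_lt_top iN') (Integrable.lintegral_lt_top iG'))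
    intro y hy h
    apply subset_tsupport
    rw [← hηψ y hy] at h
    exact h

end StokesPaper

end
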